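/- arXiv:2103.13448 — 2 statements merged into one kernel-verified Lean document; each statement's English description precedes it below -/
import Mathlib

section
/- Assume the Sathe–Selberg analogue hypothesis: there exist constants C₀, C > 0 such that #{n ∈ 𝒩 : n ≤ x, ω₁(n) = k} = (C₀ + o(1)) · (x/log x) · (log log x)^{k−1} / (2^{k−1}·(k−1)!) uniformly for 1 ≤ k ≤ C·log log x, as x → ∞. Then for every η > 0 there exist a constant c > 0 and a full density subset S ⊆ 𝒩 such that for every m ∈ S, every integer i ≥ 0, and every n ∈ 𝒩 with 2^i·(log n)^{(1/2)log 2 + η} ≤ 2^{ω₁(n)} ≤ (log n)², the number of elements of 𝒩 lying strictly between m and n is at least c·(1 + 2η/log 2)^i / ((log 2^{ω₁(n)})² · log log n). -/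
open Filter Topology

noncomputable section

/-- The set of natural numbers expressible as a sum of two squares. -/
def SOS : Set ℕ := {n | ∃ x y : ℤ, (n : ℤ) = x ^ 2 + y ^ 2}

/-- `r₂(n)`, the number of representations of `n` as a sum of two squares. -/
def r2 (n : ℕ) : ℕ := Nat.card {p : ℤ × ℤ // p.1 ^ 2 + p.2 ^ 2 = (n : ℤ)}

/-- `ω₁(n)`, the number of distinct prime factors of `n` congruent to `1` mod `4`. -/
def omega1 (n : ℕ) : ℕ := (n.primeFactors.filter fun p => p % 4 = 1).card

/-- A subset `S ⊆ 𝒩` has full density in `𝒩`. -/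
def FullDensityIn (S : Set ℕ) : Prop :=
  S ⊆ SOS ∧ Tendsto (fun x : ℕ =>
    (Nat.card {m : ℕ // m ∈ S ∧ m ≤ x} : ℝ) / (Nat.card {m : ℕ // m ∈ SOS ∧ m ≤ x} : ℝ))
    atTop (𝓝 1)

/-- The number of elements of `𝒩` lying strictly between `m` and `n`. -/
def betweenCount (m n : ℕ) : ℕ :=
  Nat.card {k : ℕ // k ∈ SOS ∧ min m n < k ∧ k < max m n}

/-- The Sathe–Selberg analogue hypothesis for `ω₁` on `𝒩`. -/
def SatheSelberg : Prop :=
  ∃ C₀ C : ℝ, 0 < C₀ ∧ 0 < C ∧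
    ∀ δ : ℝ, 0 < δ → ∃ x₀ : ℕ, ∀ x : ℕ, x₀ ≤ x → ∀ k : ℕ, 1 ≤ k →
      (k : ℝ) ≤ C * Real.log (Real.log x) →
      |(Nat.card {n : ℕ // n ∈ SOS ∧ n ≤ x ∧ omega1 n = k} : ℝ) -
          C₀ * ((x : ℝ) / Real.log x * Real.log (Real.log x) ^ (k - 1) /
            (2 ^ (k - 1) * (Nat.factorial (k - 1) : ℝ)))| ≤
        δ * ((x : ℝ) / Real.log x * Real.log (Real.log x) ^ (k - 1) /
          (2 ^ (k - 1) * (Nat.factorial (k - 1) : ℝ)))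

theorem summable_primes_rpow_neg {σ : ℝ} (hσ : 1 < σ) :
    Summable fun p : Nat.Primes ↦ (p : ℝ) ^ (-σ) :=
  Nat.Primes.summable_rpow.mpr (by linarith)

/-- The logarithm of the absolute value of a Dirichlet `L`-function on the real axis agrees with
the corresponding sum over primes up to a bounded error. -/
theorem abs_log_norm_LSeries_sub_le {N : ℕ} (χ : DirichletCharacter ℂ N) {σ : ℝ} (hσ : 1 < σ) :
    |Real.log ‖LSeries (fun n ↦ χ n) σ‖ - ∑' p : Nat.Primes, (χ p).re * (p : ℝ) ^ (-σ)| ≤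
      ∑' p : Nat.Primes, (p : ℝ) ^ (-2 : ℝ) := by
  have hσ' : 1 < (σ : ℂ).re := by simpa using hσ
  have hs := DirichletCharacter.summable_neg_log_one_sub_mul_prime_cpow (χ := χ) hσ'
  have hz (p : Nat.Primes) : (p : ℂ) ^ (-(σ : ℂ)) = (((p : ℝ) ^ (-σ) : ℝ) : ℂ) := by
    rw [Complex.ofReal_cpow (by positivity)]; simp
  have hre (p : Nat.Primes) : (χ p * (p : ℂ) ^ (-(σ : ℂ))).re = (χ p).re * (p : ℝ) ^ (-σ) := by
    rw [hz, Complex.re_mul_ofReal]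
  have hnorm (p : Nat.Primes) : ‖χ p * (p : ℂ) ^ (-(σ : ℂ))‖ ≤ (p : ℝ) ^ (-σ) := by
    rw [hz, norm_mul, Complex.norm_real, Real.norm_of_nonneg (by positivity)]
    exact mul_le_of_le_one_left (by positivity) (χ.norm_le_one _)
  have hp1 (p : Nat.Primes) : (p : ℝ) ^ (-σ) ≤ (p : ℝ) ^ (-1 : ℝ) :=
    Real.rpow_le_rpow_of_exponent_le (by exact_mod_cast p.2.one_le) (by linarith)
  have hp2 (p : Nat.Primes) : (p : ℝ) ^ (-1 : ℝ) ≤ 1 / 2 := by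
    rw [Real.rpow_neg_one, one_div]
    exact inv_anti₀ two_pos (by exact_mod_cast p.2.two_le)
  have hterm (p : Nat.Primes) :
      ‖(-Complex.log (1 - χ p * (p : ℂ) ^ (-(σ : ℂ)))).re - (χ p).re * (p : ℝ) ^ (-σ)‖ ≤
        (p : ℝ) ^ (-2 : ℝ) := by
    set z := χ p * (p : ℂ) ^ (-(σ : ℂ)) with hzdef
    have hzle : ‖z‖ ≤ (p : ℝ) ^ (-1 : ℝ) := (hnorm p).trans (hp1 p)
    have hzh : ‖z‖ ≤ 1 / 2 := hzle.trans (hp2 p)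
    have h1 := Complex.norm_log_one_add_sub_self_le (z := -z) (by rw [norm_neg]; linarith)
    rw [norm_neg] at h1
    have h2 : (1 - ‖z‖)⁻¹ ≤ 2 := by
      rw [inv_le_comm₀ (by linarith) two_pos]; linarith
    have h3 : ‖z‖ ^ 2 * (1 - ‖z‖)⁻¹ / 2 ≤ ‖z‖ ^ 2 := by nlinarith [sq_nonneg ‖z‖]
    rw [← hre p, ← Complex.sub_re, Real.norm_eq_abs]
    refine (Complex.abs_re_le_norm _).trans ?_
    have h4 : -Complex.log (1 - z) - z = -(Complex.log (1 + -z) - -z) := by ring_nf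
    rw [h4, norm_neg]
    refine (h1.trans h3).trans ?_
    calc ‖z‖ ^ 2 ≤ ((p : ℝ) ^ (-1 : ℝ)) ^ 2 := by gcongr
      _ = (p : ℝ) ^ (-2 : ℝ) := by
        rw [← Real.rpow_natCast, ← Real.rpow_mul (by positivity)]; norm_num
  have hsum2 : Summable fun p : Nat.Primes ↦ (p : ℝ) ^ (-2 : ℝ) :=
    summable_primes_rpow_neg one_lt_two
  have hsumχ : Summable fun p : Nat.Primes ↦ (χ p).re * (p : ℝ) ^ (-σ) := by
    refine (summable_primes_rpow_neg hσ).of_norm_bounded fun p ↦ ?_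
    rw [← hre p, Real.norm_eq_abs]
    exact (Complex.abs_re_le_norm _).trans (hnorm p)
  rw [← DirichletCharacter.LSeries_eulerProduct_exp_log χ hσ', Complex.norm_exp, Real.log_exp,
    Complex.re_tsum hs, ← (Complex.hasSum_re hs.hasSum).summable.tsum_sub hsumχ, ← Real.norm_eq_abs]
  exact tsum_of_norm_bounded hsum2.hasSum hterm

theorem exists_abs_log_norm_le {f : ℂ → ℂ} (hf : Continuous f)
    (h0 : ∀ σ : ℝ, 1 ≤ σ → f σ ≠ 0) :
    ∃ K : ℝ, ∀ σ : ℝ, 1 ≤ σ → σ ≤ 2 → |Real.log ‖f σ‖| ≤ K := by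
  have hc : ContinuousOn (fun σ : ℝ ↦ Real.log ‖f σ‖) (Set.Icc 1 2) :=
    ContinuousOn.log (by fun_prop) fun σ hσ ↦ norm_ne_zero_iff.mpr (h0 σ hσ.1)
  obtain ⟨K, hK⟩ := isCompact_Icc.exists_bound_of_continuousOn hc
  exact ⟨K, fun σ h1 h2 ↦ hK σ ⟨h1, h2⟩⟩

/-- The quadratic character modulo `4`, as a complex Dirichlet character. -/
def quadraticCharFour : DirichletCharacter ℂ 4 := ZMod.χ₄.ringHomComp (Int.castRingHom ℂ)

theorem quadraticCharFour_ne_one : quadraticCharFour ≠ 1 := by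
  intro h
  have h3 : quadraticCharFour (3 : ZMod 4) = 1 := by
    rw [h, MulChar.one_apply (by decide)]
  have : ZMod.χ₄ (3 : ZMod 4) = -1 := by decide
  simp only [quadraticCharFour, MulChar.ringHomComp_apply, this] at h3
  norm_num at h3

/-- The sum of `p ^ (-σ)` over the primes `p ≡ 1 mod 4`. -/
def primeSumOne (σ : ℝ) : ℝ := ∑' p : Nat.Primes, if (p : ℕ) % 4 = 1 then (p : ℝ) ^ (-σ) else 0

theorem summable_primeSumOne {σ : ℝ} (hσ : 1 < σ) :
    Summable fun p : Nat.Primes ↦ if (p : ℕ) % 4 = 1 then (p : ℝ) ^ (-σ) else 0 := by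
  refine (summable_primes_rpow_neg hσ).of_nonneg_of_le (fun p ↦ ?_) (fun p ↦ ?_) <;>
  split_ifs <;> first | positivity | exact le_rfl

theorem indicator_eq_half_add_char (p : ℕ) :
    (if p % 4 = 1 then (1 : ℝ) else 0) =
      1 / 2 * (((1 : DirichletCharacter ℂ 4) p).re + (quadraticCharFour p).re) := by
  have key : ∀ a : ZMod 4, ((1 : DirichletCharacter ℂ 4) a).re + (quadraticCharFour a).re =
      if a = 1 then 2 else 0 := by
    intro a
    by_cases ha : IsUnit a
    · rw [MulChar.one_apply ha]
      simp only [quadraticCharFour, MulChar.ringHomComp_apply]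
      have hcases : ∀ a : ZMod 4, IsUnit a → (a = 1 ∧ ZMod.χ₄ a = 1) ∨ (a ≠ 1 ∧ ZMod.χ₄ a = -1) := by
        decide
      rcases hcases a ha with ⟨h1, h2⟩ | ⟨h1, h2⟩ <;> (rw [h2]; simp [h1]; try norm_num)
    · rw [MulChar.map_nonunit _ ha, MulChar.map_nonunit _ ha]
      have : a ≠ 1 := by rintro rfl; exact ha isUnit_one
      simp [this]
  rw [key]
  have hiff : ((p : ℕ) : ZMod 4) = 1 ↔ p % 4 = 1 := by
    have := ZMod.natCast_eq_natCast_iff' p 1 4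
    simpa using this
  simp only [hiff]
  split_ifs <;> norm_num

/-- `∑ p ^ (-σ)` over `p ≡ 1 mod 4` equals `log (1 / (σ - 1)) / 2 + O(1)` as `σ → 1⁺`. -/
theorem exists_abs_primeSumOne_add_log_le :
    ∃ K : ℝ, ∀ σ : ℝ, 1 < σ → σ ≤ 2 →
      |primeSumOne σ + 1 / 2 * Real.log (σ - 1)| ≤ K := by
  obtain ⟨K₁, hK₁⟩ := exists_abs_log_norm_le
    (DirichletCharacter.differentiable_LFunction quadraticCharFour_ne_one).continuous
    (fun σ hσ ↦ DirichletCharacter.LFunction_ne_zero_of_one_le_re _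
      (Or.inl quadraticCharFour_ne_one) (by simpa using hσ))
  obtain ⟨K₂, hK₂⟩ := exists_abs_log_norm_le
    (DirichletCharacter.differentiable_LFunctionTrivChar₁ 4).continuous
    (fun σ hσ ↦ by
      rcases eq_or_ne σ 1 with rfl | h1
      · simpa using DirichletCharacter.LFunctionTrivChar₁_apply_one_ne_zero 4
      · have h1' : (σ : ℂ) ≠ 1 := by exact_mod_cast h1
        rw [DirichletCharacter.LFunctionTrivChar₁, Function.update_of_ne h1']
        exact mul_ne_zero (sub_ne_zero.mpr h1')
          (DirichletCharacter.LFunction_ne_zero_of_one_le_re _ (Or.inr h1') (by simpa using hσ)))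
  set T := ∑' p : Nat.Primes, (p : ℝ) ^ (-2 : ℝ)
  refine ⟨1 / 2 * (K₁ + K₂) + T, fun σ h1 h2 ↦ ?_⟩
  have hre : 1 < (σ : ℂ).re := by simpa using h1
  have hne : (σ : ℂ) ≠ 1 := by exact_mod_cast h1.ne'
  have a1 := abs_log_norm_LSeries_sub_le quadraticCharFour h1
  have a2 := abs_log_norm_LSeries_sub_le (1 : DirichletCharacter ℂ 4) h1
  have b1 := hK₁ σ h1.le h2
  have b2 := hK₂ σ h1.le h2
  rw [DirichletCharacter.LFunction_eq_LSeries _ hre] at b1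
  rw [DirichletCharacter.LFunctionTrivChar₁, Function.update_of_ne hne,
    DirichletCharacter.LFunctionTrivChar,
    DirichletCharacter.LFunction_eq_LSeries _ hre, norm_mul] at b2
  have hn : ‖(σ : ℂ) - 1‖ = σ - 1 := by
    rw [← Complex.ofReal_one, ← Complex.ofReal_sub, Complex.norm_real,
      Real.norm_of_nonneg (by linarith)]
  have hL : LSeries (fun n ↦ (1 : DirichletCharacter ℂ 4) n) σ ≠ 0 := by
    rw [← DirichletCharacter.LFunction_eq_LSeries _ hre]
    exact DirichletCharacter.LFunction_ne_zero_of_one_le_re _ (Or.inr hne) hre.le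
  rw [hn, Real.log_mul (by linarith) (norm_ne_zero_iff.mpr hL)] at b2
  have hsum (χ : DirichletCharacter ℂ 4) :
      Summable fun p : Nat.Primes ↦ (χ p).re * (p : ℝ) ^ (-σ) := by
    refine (summable_primes_rpow_neg h1).of_norm_bounded fun p ↦ ?_
    rw [norm_mul, Real.norm_of_nonneg (by positivity : (0 : ℝ) ≤ (p : ℝ) ^ (-σ))]
    exact mul_le_of_le_one_left (by positivity)
      ((Complex.abs_re_le_norm _).trans (χ.norm_le_one _))
  have hsplit : primeSumOne σ = 1 / 2 *
      (∑' p : Nat.Primes, ((1 : DirichletCharacter ℂ 4) p).re * (p : ℝ) ^ (-σ) +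
        ∑' p : Nat.Primes, (quadraticCharFour p).re * (p : ℝ) ^ (-σ)) := by
    rw [← (hsum _).tsum_add (hsum _), ← tsum_mul_left]
    refine tsum_congr fun p ↦ ?_
    rw [← add_mul, ← mul_assoc, ← indicator_eq_half_add_char]
    split_ifs <;> simp
  rw [hsplit]
  rw [abs_le] at *
  constructor <;> linarith [a1.1, a1.2, a2.1, a2.2, b1.1, b1.2, b2.1, b2.2]

theorem mem_SOS_iff {n : ℕ} : n ∈ SOS ↔ ∃ x y : ℕ, n = x ^ 2 + y ^ 2 := by
  constructor
  · rintro ⟨x, y, h⟩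
    refine ⟨x.natAbs, y.natAbs, ?_⟩
    zify
    simpa using h
  · rintro ⟨x, y, h⟩
    exact ⟨x, y, by exact_mod_cast h⟩

theorem mul_mem_SOS {m n : ℕ} (hm : m ∈ SOS) (hn : n ∈ SOS) : m * n ∈ SOS := by
  rw [mem_SOS_iff] at *
  obtain ⟨x, y, h⟩ := hm
  obtain ⟨u, v, h'⟩ := hn
  exact Nat.sq_add_sq_mul h h'

theorem sq_mem_SOS (s : ℕ) : s ^ 2 ∈ SOS := mem_SOS_iff.mpr ⟨s, 0, by simp⟩

theorem mem_SOS_of_forall_prime {b : ℕ} (h : ∀ p : ℕ, p.Prime → p ∣ b → p % 4 ≠ 3) : b ∈ SOS := by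
  rw [mem_SOS_iff, Nat.eq_sq_add_sq_iff]
  intro q hq hq3
  exact absurd hq3 (h q (Nat.prime_of_mem_primeFactors hq) (Nat.dvd_of_mem_primeFactors hq))

theorem prime_mem_SOS {p : ℕ} (hp : p.Prime) (h : p % 4 = 1) : p ∈ SOS :=
  mem_SOS_of_forall_prime fun q hq hqp ↦ by
    rw [(Nat.prime_dvd_prime_iff_eq hq hp).mp hqp]; omega

/-- A positive sum of two squares is a square times a squarefree number without prime factors
congruent to `3` modulo `4`. -/
theorem exists_eq_sq_mul_of_mem_SOS {n : ℕ} (hn : n ∈ SOS) (h0 : n ≠ 0) :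
    ∃ s b : ℕ, n = s ^ 2 * b ∧ Squarefree b ∧ ∀ p : ℕ, p.Prime → p ∣ b → p % 4 ≠ 3 := by
  obtain ⟨b, s, hbs, hb⟩ := Nat.sq_mul_squarefree n
  refine ⟨s, b, hbs.symm, hb, fun p hp hpb h3 ↦ ?_⟩
  rw [mem_SOS_iff, Nat.eq_sq_add_sq_iff] at hn
  have hs0 : s ≠ 0 := by rintro rfl; simp at hbs; omega
  have hb0 : b ≠ 0 := hb.ne_zero
  have hev := hn p (Nat.mem_primeFactors.mpr ⟨hp, hbs ▸ hpb.mul_left _, h0⟩) h3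
  have : Fact p.Prime := ⟨hp⟩
  rw [← hbs, padicValNat.mul (pow_ne_zero _ hs0) hb0, padicValNat.pow] at hev
  have h1 : padicValNat p b = 1 := by
    rw [← Nat.factorization_def _ hp]
    have := (Nat.squarefree_iff_factorization_le_one hb0).mp hb p
    have h2 := hp.factorization_pos_of_dvd hb0 hpb
    omega
  rw [h1] at hev
  rcases hev with ⟨k, hk⟩
  omega

theorem omega1_mul_le {m n : ℕ} : omega1 (m * n) ≤ omega1 m + omega1 n := by
  rcases eq_or_ne m 0 with rfl | hm
  · simp [omega1]
  rcases eq_or_ne n 0 with rfl | hn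
  · simp [omega1]
  unfold omega1
  rw [Nat.primeFactors_mul hm hn, Finset.filter_union]
  exact Finset.card_union_le _ _

theorem omega1_le_of_isPrimePow {q : ℕ} (hq : IsPrimePow q) : omega1 q ≤ 1 := by
  unfold omega1
  refine (Finset.card_filter_le _ _).trans ?_
  obtain ⟨p, k, hp, hk, rfl⟩ := hq
  rw [Nat.primeFactors_prime_pow hk.ne' hp.nat_prime, Finset.card_singleton]

/-- `ρ ^ ω₁(n)` is smaller than any power of `n`. -/
theorem exists_pow_omega1_le {ρ ε : ℝ} (hρ : 1 ≤ ρ) (hε : 0 < ε) :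
    ∃ C : ℝ, 0 < C ∧ ∀ n : ℕ, n ≠ 0 → ρ ^ omega1 n ≤ C * (n : ℝ) ^ ε := by
  obtain ⟨M, hM⟩ := exists_nat_ge (ρ ^ (1 / ε))
  refine ⟨ρ ^ M, by positivity, fun n hn ↦ ?_⟩
  have hbig (p : ℕ) (hp : M ≤ p) : ρ ≤ (p : ℝ) ^ ε := by
    calc ρ = (ρ ^ (1 / ε)) ^ ε := by
          rw [← Real.rpow_mul (by linarith), one_div_mul_cancel hε.ne', Real.rpow_one]
      _ ≤ (p : ℝ) ^ ε := by
          gcongr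
          exact hM.trans (by exact_mod_cast hp)
  have hone (p : ℕ) (hp : p ∈ n.primeFactors) : 1 ≤ (p : ℝ) ^ ε :=
    Real.one_le_rpow (by exact_mod_cast (Nat.prime_of_mem_primeFactors hp).one_le) hε.le
  calc ρ ^ omega1 n ≤ ρ ^ n.primeFactors.card :=
        pow_le_pow_right₀ hρ (Finset.card_filter_le _ _)
    _ = ∏ p ∈ n.primeFactors, ρ := by rw [Finset.prod_const]
    _ ≤ ∏ p ∈ n.primeFactors, (if p < M then ρ else 1) * (p : ℝ) ^ ε := by
        refine Finset.prod_le_prod (fun _ _ ↦ by linarith) fun p hp ↦ ?_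
        split_ifs with h
        · exact le_mul_of_one_le_right (by linarith) (hone p hp)
        · rw [one_mul]; exact hbig p (by omega)
    _ = ρ ^ (n.primeFactors.filter (· < M)).card * (∏ p ∈ n.primeFactors, (p : ℝ)) ^ ε := by
        rw [Finset.prod_mul_distrib, Finset.prod_ite, Finset.prod_const, Finset.prod_const_one,
          mul_one, Real.finsetProd_rpow _ _ fun _ _ ↦ by positivity]
    _ ≤ ρ ^ M * (n : ℝ) ^ ε := by
        gcongr
        · calc (n.primeFactors.filter (· < M)).card ≤ (Finset.range M).card :=
                Finset.card_le_card fun p hp ↦ by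
                  simpa using (Finset.mem_filter.mp hp).2
            _ = M := Finset.card_range M
        · rw [← Nat.cast_prod]
          exact Nat.cast_le.mpr (Nat.le_of_dvd (Nat.pos_of_ne_zero hn) (Nat.prod_primeFactors_dvd n))

open scoped Classical in
/-- The positive sums of two squares up to `N`. -/
def sosIcc (N : ℕ) : Finset ℕ := (Finset.Icc 1 N).filter (· ∈ SOS)

theorem mem_sosIcc {N n : ℕ} : n ∈ sosIcc N ↔ 1 ≤ n ∧ n ≤ N ∧ n ∈ SOS := by
  simp [sosIcc, and_assoc]

theorem log_le_sum_vonMangoldt {N n d e : ℕ} (hdN : d ≤ N)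
    (hd : ∀ q, q ∣ d → ∃ m ∈ sosIcc N, q ^ e * m = n) :
    Real.log d ≤ ∑ m ∈ sosIcc N, ∑ q ∈ Finset.Ioc 0 N,
      if q ^ e * m = n then ArithmeticFunction.vonMangoldt q else 0 := by
  rw [← ArithmeticFunction.vonMangoldt_sum, Finset.sum_comm]
  have hnn (q m : ℕ) : 0 ≤ if q ^ e * m = n then ArithmeticFunction.vonMangoldt q else 0 := by
    split_ifs
    · exact ArithmeticFunction.vonMangoldt_nonneg
    · exact le_rfl
  calc ∑ q ∈ d.divisors, ArithmeticFunction.vonMangoldt q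
      ≤ ∑ q ∈ d.divisors, ∑ m ∈ sosIcc N,
          if q ^ e * m = n then ArithmeticFunction.vonMangoldt q else 0 := by
        refine Finset.sum_le_sum fun q hq ↦ ?_
        obtain ⟨m, hm, hqm⟩ := hd q (Nat.dvd_of_mem_divisors hq)
        refine le_trans ?_ (Finset.single_le_sum (fun m _ ↦ hnn q m) hm)
        rw [if_pos hqm]
    _ ≤ _ := by
        refine Finset.sum_le_sum_of_subset_of_nonneg (fun q hq ↦ ?_)
          fun q _ _ ↦ Finset.sum_nonneg fun m _ ↦ hnn q m
        exact Finset.mem_Ioc.mpr ⟨Nat.pos_of_mem_divisors hq,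
          (Nat.divisor_le hq).trans hdN⟩

theorem sum_pow_omega1_mul_le {ρ : ℝ} (hρ : 1 ≤ ρ) (N : ℕ) {e : ℕ} (he : e ≠ 0) :
    ∑ n ∈ sosIcc N, ρ ^ omega1 n * (∑ m ∈ sosIcc N, ∑ q ∈ Finset.Ioc 0 N,
      if q ^ e * m = n then ArithmeticFunction.vonMangoldt q else 0) ≤
    ρ * (Real.log 4 + 4) * N * ∑ m ∈ sosIcc N, ρ ^ omega1 m / m := by
  have hρ0 : 0 ≤ ρ := by linarith
  calc ∑ n ∈ sosIcc N, ρ ^ omega1 n * (∑ m ∈ sosIcc N, ∑ q ∈ Finset.Ioc 0 N,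
      if q ^ e * m = n then ArithmeticFunction.vonMangoldt q else 0)
      = ∑ m ∈ sosIcc N, ∑ q ∈ Finset.Ioc 0 N, ∑ n ∈ sosIcc N,
          ρ ^ omega1 n * if q ^ e * m = n then ArithmeticFunction.vonMangoldt q else 0 := by
        simp_rw [Finset.mul_sum]
        rw [Finset.sum_comm]
        exact Finset.sum_congr rfl fun m _ ↦ Finset.sum_comm
    _ ≤ ∑ m ∈ sosIcc N, ∑ q ∈ Finset.Ioc 0 N,
          if q ≤ ⌊(N : ℝ) / m⌋₊ then ρ * ρ ^ omega1 m * ArithmeticFunction.vonMangoldt q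
          else 0 := by
        refine Finset.sum_le_sum fun m hm ↦ Finset.sum_le_sum fun q hq ↦ ?_
        have hm1 : 1 ≤ m := (mem_sosIcc.mp hm).1
        have hq1 : 1 ≤ q := (Finset.mem_Ioc.mp hq).1
        have hΛ : 0 ≤ ArithmeticFunction.vonMangoldt q := ArithmeticFunction.vonMangoldt_nonneg
        by_cases hN : q ^ e * m ∈ sosIcc N
        · have hle : q ≤ ⌊(N : ℝ) / m⌋₊ := by
            rw [Nat.floor_div_natCast, Nat.floor_natCast, Nat.le_div_iff_mul_le (by omega)]
            exact (Nat.mul_le_mul_right _ (Nat.le_self_pow he q)).trans (mem_sosIcc.mp hN).2.1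
          rw [if_pos hle]
          simp only [mul_ite, mul_zero, Finset.sum_ite_eq, hN, if_true]
          by_cases hpp : IsPrimePow q
          · refine mul_le_mul_of_nonneg_right ?_ hΛ
            rw [← pow_succ']
            refine pow_le_pow_right₀ hρ (omega1_mul_le.trans ?_)
            have := omega1_le_of_isPrimePow (hpp.pow he)
            omega
          · rw [ArithmeticFunction.vonMangoldt_eq_zero_iff.mpr hpp]
            simp
        · simp only [mul_ite, mul_zero, Finset.sum_ite_eq, hN, if_false]
          split_ifs <;> positivity
    _ ≤ ∑ m ∈ sosIcc N, ρ * ρ ^ omega1 m * Chebyshev.psi ((N : ℝ) / m) := by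
        refine Finset.sum_le_sum fun m hm ↦ ?_
        rw [Chebyshev.psi, Finset.mul_sum, ← Finset.sum_filter]
        refine Finset.sum_le_sum_of_subset_of_nonneg (fun q hq ↦ ?_) fun q _ _ ↦ ?_
        · simp only [Finset.mem_filter, Finset.mem_Ioc] at hq ⊢
          exact ⟨hq.1.1, hq.2⟩
        · have : 0 ≤ ArithmeticFunction.vonMangoldt q := ArithmeticFunction.vonMangoldt_nonneg
          positivity
    _ ≤ ∑ m ∈ sosIcc N, ρ * ρ ^ omega1 m * ((Real.log 4 + 4) * ((N : ℝ) / m)) := by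
        gcongr
        exact Chebyshev.psi_le_const_mul_self (by positivity)
    _ = _ := by
        rw [Finset.mul_sum]
        exact Finset.sum_congr rfl fun m _ ↦ by ring

theorem log_le_of_mem_sosIcc {N n : ℕ} (hn : n ∈ sosIcc N) :
    Real.log n ≤
      (∑ m ∈ sosIcc N, ∑ q ∈ Finset.Ioc 0 N,
        if q ^ 1 * m = n then ArithmeticFunction.vonMangoldt q else 0) +
      2 * ∑ m ∈ sosIcc N, ∑ q ∈ Finset.Ioc 0 N,
        if q ^ 2 * m = n then ArithmeticFunction.vonMangoldt q else 0 := by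
  obtain ⟨hn1, hnN, hnS⟩ := mem_sosIcc.mp hn
  obtain ⟨s, b, rfl, -, hb⟩ := exists_eq_sq_mul_of_mem_SOS hnS (by omega)
  have hs0 : s ≠ 0 := by rintro rfl; simp at hn1
  have hb0 : b ≠ 0 := by rintro rfl; simp at hn1
  have hmem {t c : ℕ} (ht : t ∣ s) (hc : c ∣ b) : t ^ 2 * c ∈ sosIcc N := by
    refine mem_sosIcc.mpr ⟨?_, ?_, ?_⟩
    · exact Nat.pos_of_ne_zero (mul_ne_zero (pow_ne_zero _ (ne_zero_of_dvd_ne_zero hs0 ht))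
        (ne_zero_of_dvd_ne_zero hb0 hc))
    · exact (Nat.le_of_dvd hn1 (mul_dvd_mul (pow_dvd_pow_of_dvd ht 2) hc)).trans hnN
    · exact mul_mem_SOS (sq_mem_SOS t)
        (mem_SOS_of_forall_prime fun p hp hpc ↦ hb p hp (hpc.trans hc))
  have h1 : Real.log b ≤ _ := log_le_sum_vonMangoldt (N := N) (n := s ^ 2 * b) (e := 1)
    ((Nat.le_mul_of_pos_left _ (by positivity)).trans hnN) fun q ⟨c, hc⟩ ↦
      ⟨s ^ 2 * c, hmem dvd_rfl ⟨q, by rw [hc, mul_comm]⟩, by rw [hc]; ring⟩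
  have h2 : Real.log s ≤ _ := log_le_sum_vonMangoldt (N := N) (n := s ^ 2 * b) (e := 2)
    ((Nat.le_self_pow two_ne_zero s).trans
      ((Nat.le_mul_of_pos_right _ (by omega)).trans hnN)) fun q ⟨c, hc⟩ ↦
      ⟨c ^ 2 * b, hmem ⟨q, by rw [hc, mul_comm]⟩ dvd_rfl, by rw [hc]; ring⟩
  have h3 : Real.log ((s ^ 2 * b : ℕ) : ℝ) = 2 * Real.log s + Real.log b := by
    push_cast
    rw [Real.log_mul (by positivity) (by positivity), Real.log_pow]
    norm_num
  rw [h3]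
  linarith

/-- The partial sums of `ρ ^ ω₁` over sums of two squares are controlled by its logarithmic
partial sums. -/
theorem log_mul_sum_pow_omega1_le {ρ : ℝ} (hρ : 1 ≤ ρ) {N : ℕ} (hN : N ≠ 0) :
    Real.log N * ∑ n ∈ sosIcc N, ρ ^ omega1 n ≤
      (3 * (ρ * (Real.log 4 + 4)) + 1) * N * ∑ m ∈ sosIcc N, ρ ^ omega1 m / m := by
  have hρ0 : 0 ≤ ρ := by linarith
  have hterm (n : ℕ) (hn : n ∈ sosIcc N) : Real.log N * ρ ^ omega1 n ≤
      ρ ^ omega1 n * (∑ m ∈ sosIcc N, ∑ q ∈ Finset.Ioc 0 N,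
        if q ^ 1 * m = n then ArithmeticFunction.vonMangoldt q else 0) +
      2 * (ρ ^ omega1 n * ∑ m ∈ sosIcc N, ∑ q ∈ Finset.Ioc 0 N,
        if q ^ 2 * m = n then ArithmeticFunction.vonMangoldt q else 0) +
      N * (ρ ^ omega1 n / n) := by
    have hn1 : (1 : ℝ) ≤ n := by exact_mod_cast (mem_sosIcc.mp hn).1
    have hlog : Real.log N ≤ Real.log n + N / n := by
      have := Real.log_le_self (x := (N : ℝ) / n) (by positivity)
      rw [Real.log_div (by positivity) (by positivity)] at this
      linarith
    have h := mul_le_mul_of_nonneg_right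
      (hlog.trans (add_le_add_left (log_le_of_mem_sosIcc hn) _)) (pow_nonneg hρ0 (omega1 n))
    refine h.trans (le_of_eq ?_)
    ring
  rw [Finset.mul_sum]
  refine (Finset.sum_le_sum hterm).trans ?_
  rw [Finset.sum_add_distrib, Finset.sum_add_distrib, ← Finset.mul_sum, ← Finset.mul_sum]
  have h1 := sum_pow_omega1_mul_le hρ N one_ne_zero
  have h2 := sum_pow_omega1_mul_le hρ N two_ne_zero
  linarith

theorem sum_primes_le_primeSumOne {σ : ℝ} (hσ : 1 < σ) (P : Finset ℕ) (hP : ∀ p ∈ P, p.Prime) :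
    ∑ p ∈ P, (if p % 4 = 1 then (p : ℝ) ^ (-σ) else 0) ≤ primeSumOne σ := by
  rw [← Finset.sum_subtype_of_mem (fun p : ℕ ↦ if p % 4 = 1 then (p : ℝ) ^ (-σ) else 0) hP]
  have h (Q : Finset Nat.Primes) := (summable_primeSumOne hσ).sum_le_tsum Q fun p _ ↦ by
    split_ifs <;> positivity
  exact h (P.subtype Nat.Prime)

theorem omega1_sq_mul_prod_le (s : ℕ) (t : Finset ℕ) (ht : ∀ p ∈ t, p.Prime) :
    omega1 (s ^ 2 * ∏ p ∈ t, p) ≤ omega1 s + (t.filter fun p ↦ p % 4 = 1).card := by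
  refine omega1_mul_le.trans ?_
  simp only [omega1, Nat.primeFactors_prod ht, Nat.primeFactors_pow s two_ne_zero, le_refl]

theorem sosIcc_subset_image (N : ℕ) :
    sosIcc N ⊆ (Finset.Icc 1 N ×ˢ
      ((Finset.Icc 1 N).filter fun p ↦ p.Prime ∧ p % 4 ≠ 3).powerset).image
        fun x ↦ x.1 ^ 2 * ∏ p ∈ x.2, p := by
  intro n hn
  obtain ⟨hn1, hnN, hnS⟩ := mem_sosIcc.mp hn
  obtain ⟨s, b, rfl, hsq, hb⟩ := exists_eq_sq_mul_of_mem_SOS hnS (by omega)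
  have hs0 : s ≠ 0 := by rintro rfl; simp at hn1
  refine Finset.mem_image.mpr ⟨(s, b.primeFactors), ?_, ?_⟩
  · rw [Finset.mem_product, Finset.mem_powerset]
    refine ⟨Finset.mem_Icc.mpr ⟨Nat.pos_of_ne_zero hs0, ?_⟩, fun p hp ↦ ?_⟩
    · exact (Nat.le_self_pow two_ne_zero s).trans
        ((Nat.le_mul_of_pos_right _ (Nat.pos_of_ne_zero hsq.ne_zero)).trans hnN)
    · have hpp := Nat.prime_of_mem_primeFactors hp
      have hpb := Nat.dvd_of_mem_primeFactors hp
      refine Finset.mem_filter.mpr ⟨Finset.mem_Icc.mpr ⟨hpp.one_le, ?_⟩, hpp, hb p hpp hpb⟩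
      exact (Nat.le_of_dvd (Nat.pos_of_ne_zero hsq.ne_zero) hpb).trans
        ((Nat.le_mul_of_pos_left _ (by positivity)).trans hnN)
  · simp only [Nat.prod_primeFactors_of_squarefree hsq]

theorem prod_one_add_le_exp {ρ σ : ℝ} (hρ : 1 ≤ ρ) (hσ : 1 < σ) (P : Finset ℕ)
    (hP : ∀ p ∈ P, p.Prime ∧ p % 4 ≠ 3) :
    ∏ p ∈ P, (1 + (if p % 4 = 1 then ρ else 1) * (p : ℝ) ^ (-σ)) ≤
      Real.exp (1 + ρ * primeSumOne σ) := by
  have hρ0 : 0 ≤ ρ := by linarith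
  calc ∏ p ∈ P, (1 + (if p % 4 = 1 then ρ else 1) * (p : ℝ) ^ (-σ))
      ≤ ∏ p ∈ P, Real.exp ((if p % 4 = 1 then ρ else 1) * (p : ℝ) ^ (-σ)) := by
        refine Finset.prod_le_prod (fun p _ ↦ ?_) fun p _ ↦ ?_
        · split_ifs <;> positivity
        · rw [add_comm]; exact Real.add_one_le_exp _
    _ = Real.exp (∑ p ∈ P, (if p % 4 = 1 then ρ else 1) * (p : ℝ) ^ (-σ)) :=
        (Real.exp_sum _ _).symm
    _ ≤ _ := by
        refine Real.exp_le_exp.mpr ?_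
        calc ∑ p ∈ P, (if p % 4 = 1 then ρ else 1) * (p : ℝ) ^ (-σ)
            ≤ ∑ p ∈ P, ((if p = 2 then 1 else 0) +
                ρ * if p % 4 = 1 then (p : ℝ) ^ (-σ) else 0) := by
              refine Finset.sum_le_sum fun p hp ↦ ?_
              obtain ⟨hpp, h3⟩ := hP p hp
              by_cases h1 : p % 4 = 1
              · have h2 : p ≠ 2 := by rintro rfl; omega
                simp [h1, h2]
              · have h2 : p = 2 := by
                  rcases hpp.eq_two_or_odd with h | h
                  · exact h
                  · omega
                subst h2
                have : ((2 : ℕ) : ℝ) ^ (-σ) ≤ 1 :=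
                  Real.rpow_le_one_of_one_le_of_nonpos (by norm_num) (by linarith)
                simpa using this
          _ ≤ 1 + ρ * primeSumOne σ := by
              rw [Finset.sum_add_distrib, ← Finset.mul_sum]
              gcongr
              · rw [Finset.sum_ite_eq']
                split_ifs <;> norm_num
              · exact sum_primes_le_primeSumOne hσ P fun p hp ↦ (hP p hp).1

theorem exists_sum_pow_omega1_mul_rpow_le {ρ : ℝ} (hρ : 1 ≤ ρ) :
    ∃ C : ℝ, 0 < C ∧ ∀ (N : ℕ) (σ : ℝ), 1 < σ →
      ∑ n ∈ sosIcc N, ρ ^ omega1 n * (n : ℝ) ^ (-σ) ≤ C * Real.exp (ρ * primeSumOne σ) := by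
  have hρ0 : 0 ≤ ρ := by linarith
  obtain ⟨C, hC, hω⟩ := exists_pow_omega1_le hρ (show (0 : ℝ) < 1 / 2 by norm_num)
  have hsum : Summable fun s : ℕ ↦ (s : ℝ) ^ (-(3 / 2) : ℝ) :=
    Real.summable_nat_rpow.mpr (by norm_num)
  set Z := ∑' s : ℕ, (s : ℝ) ^ (-(3 / 2) : ℝ)
  have hZ : 0 < Z := hsum.tsum_pos (fun s ↦ by positivity) 1 (by norm_num)
  refine ⟨C * Z * Real.exp 1, by positivity, fun N σ hσ ↦ ?_⟩
  set P := (Finset.Icc 1 N).filter fun p ↦ p.Prime ∧ p % 4 ≠ 3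
  have hP : ∀ p ∈ P, p.Prime ∧ p % 4 ≠ 3 := fun p hp ↦ (Finset.mem_filter.mp hp).2
  have hnn (n : ℕ) : 0 ≤ ρ ^ omega1 n * (n : ℝ) ^ (-σ) := by positivity
  calc ∑ n ∈ sosIcc N, ρ ^ omega1 n * (n : ℝ) ^ (-σ)
      ≤ ∑ x ∈ Finset.Icc 1 N ×ˢ P.powerset, ρ ^ omega1 (x.1 ^ 2 * ∏ p ∈ x.2, p) *
          ((x.1 ^ 2 * ∏ p ∈ x.2, p : ℕ) : ℝ) ^ (-σ) :=
        (Finset.sum_le_sum_of_subset_of_nonneg (sosIcc_subset_image N) fun n _ _ ↦ hnn n).trans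
          (Finset.sum_image_le_of_nonneg
            (f := fun n : ℕ ↦ ρ ^ omega1 n * (n : ℝ) ^ (-σ)) fun n _ ↦ hnn n)
    _ ≤ ∑ x ∈ Finset.Icc 1 N ×ˢ P.powerset, (C * (x.1 : ℝ) ^ (-(3 / 2) : ℝ)) *
          ∏ p ∈ x.2, ((if p % 4 = 1 then ρ else 1) * (p : ℝ) ^ (-σ)) := by
        refine Finset.sum_le_sum fun x hx ↦ ?_
        obtain ⟨s, t⟩ := x
        rw [Finset.mem_product, Finset.mem_powerset, Finset.mem_Icc] at hx
        obtain ⟨⟨hs, -⟩, ht⟩ := hx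
        dsimp only at hs ht ⊢
        have hs1 : (1 : ℝ) ≤ s := by exact_mod_cast hs
        have hs' : (((s : ℝ) ^ 2) ^ (-σ)) ≤ (s : ℝ) ^ (-2 : ℝ) := by
          rw [← Real.rpow_natCast, ← Real.rpow_mul (by positivity)]
          exact Real.rpow_le_rpow_of_exponent_le hs1 (by push_cast; linarith)
        push_cast
        rw [Real.mul_rpow (by positivity) (by positivity),
          ← Real.finsetProd_rpow _ _ fun _ _ ↦ by positivity, Finset.prod_mul_distrib,
          Finset.prod_ite, Finset.prod_const, Finset.prod_const_one, mul_one]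
        calc _ ≤ ρ ^ (omega1 s + (t.filter fun p ↦ p % 4 = 1).card) *
                ((s : ℝ) ^ (-2 : ℝ) * ∏ p ∈ t, (p : ℝ) ^ (-σ)) := by
              gcongr
              exact omega1_sq_mul_prod_le s t fun p hp ↦ (hP p (ht hp)).1
          _ = (ρ ^ omega1 s * (s : ℝ) ^ (-2 : ℝ)) *
                (ρ ^ (t.filter fun p ↦ p % 4 = 1).card * ∏ p ∈ t, (p : ℝ) ^ (-σ)) := by
              rw [pow_add]; ring
          _ ≤ _ := by
              refine mul_le_mul_of_nonneg_right ?_ (by positivity)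
              refine (mul_le_mul_of_nonneg_right (hω s (by omega)) (by positivity)).trans_eq ?_
              rw [mul_assoc, ← Real.rpow_add (by positivity)]
              norm_num
    _ = (∑ s ∈ Finset.Icc 1 N, C * (s : ℝ) ^ (-(3 / 2) : ℝ)) *
          ∏ p ∈ P, (1 + (if p % 4 = 1 then ρ else 1) * (p : ℝ) ^ (-σ)) := by
        rw [Finset.prod_one_add, Finset.sum_mul_sum, Finset.sum_product]
    _ ≤ (C * Z) * Real.exp (1 + ρ * primeSumOne σ) := by
        refine mul_le_mul ?_ (prod_one_add_le_exp hρ hσ P hP) ?_ (by positivity)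
        · rw [← Finset.mul_sum]
          gcongr
          exact hsum.sum_le_tsum _ fun s _ ↦ by positivity
        · refine Finset.prod_nonneg fun p _ ↦ ?_
          split_ifs <;> positivity
    _ = _ := by rw [Real.exp_add]; ring

/-- Upper bound for the logarithmic partial sums of `ρ ^ ω₁` over sums of two squares. -/
theorem exists_sum_pow_omega1_div_le {ρ : ℝ} (hρ : 1 ≤ ρ) :
    ∃ C : ℝ, 0 < C ∧ ∀ N : ℕ, 3 ≤ N →
      ∑ n ∈ sosIcc N, ρ ^ omega1 n / n ≤ C * Real.log N ^ (ρ / 2) := by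
  have hρ0 : 0 ≤ ρ := by linarith
  obtain ⟨C, hC, hsum⟩ := exists_sum_pow_omega1_mul_rpow_le hρ
  obtain ⟨K, hK⟩ := exists_abs_primeSumOne_add_log_le
  refine ⟨Real.exp 1 * C * Real.exp (ρ * K), by positivity, fun N hN ↦ ?_⟩
  have hN3 : (3 : ℝ) ≤ N := by exact_mod_cast hN
  have hlog : 1 ≤ Real.log N := by
    rw [Real.le_log_iff_exp_le (by linarith)]
    linarith [Real.exp_one_lt_d9]
  have hinv : 1 / Real.log N ≤ 1 := (div_le_one (by linarith)).mpr hlog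
  have hinv0 : 0 < 1 / Real.log N := by positivity
  have hσ : 1 < 1 + 1 / Real.log N := by linarith
  have hprime : primeSumOne (1 + 1 / Real.log N) ≤ K + 1 / 2 * Real.log (Real.log N) := by
    have := (abs_le.mp (hK _ hσ (by linarith))).2
    have hl : Real.log (1 / Real.log N) = -Real.log (Real.log N) := by rw [one_div, Real.log_inv]
    rw [add_sub_cancel_left, hl] at this
    linarith
  calc ∑ n ∈ sosIcc N, ρ ^ omega1 n / n
      ≤ ∑ n ∈ sosIcc N, Real.exp 1 * (ρ ^ omega1 n * (n : ℝ) ^ (-(1 + 1 / Real.log N))) := by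
        refine Finset.sum_le_sum fun n hn ↦ ?_
        obtain ⟨hn1, hnN, -⟩ := mem_sosIcc.mp hn
        have hn0 : (0 : ℝ) < n := by exact_mod_cast hn1
        have h1 : (n : ℝ) ^ (1 / Real.log N) ≤ Real.exp 1 := by
          rw [Real.rpow_def_of_pos hn0, Real.exp_le_exp, mul_one_div, div_le_one (by linarith)]
          exact Real.log_le_log hn0 (by exact_mod_cast hnN)
        have h2 : (n : ℝ)⁻¹ = (n : ℝ) ^ (1 / Real.log N) * (n : ℝ) ^ (-(1 + 1 / Real.log N)) := by
          rw [← Real.rpow_add hn0, ← Real.rpow_neg_one]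
          congr 1; ring
        rw [div_eq_mul_inv, h2, mul_left_comm]
        gcongr
    _ ≤ Real.exp 1 * (C * Real.exp (ρ * primeSumOne (1 + 1 / Real.log N))) := by
        rw [← Finset.mul_sum]
        gcongr
        exact hsum N _ hσ
    _ ≤ Real.exp 1 * (C * Real.exp (ρ * (K + 1 / 2 * Real.log (Real.log N)))) := by gcongr
    _ = _ := by
        rw [Real.rpow_def_of_pos (by linarith), mul_add, Real.exp_add,
          show ρ * (1 / 2 * Real.log (Real.log N)) = Real.log (Real.log N) * (ρ / 2) by ring]
        ring

/-- Upper bound for the partial sums of `ρ ^ ω₁` over sums of two squares. -/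
theorem exists_sum_pow_omega1_le {ρ : ℝ} (hρ : 1 ≤ ρ) :
    ∃ C : ℝ, 0 < C ∧ ∀ N : ℕ, 3 ≤ N →
      ∑ n ∈ sosIcc N, ρ ^ omega1 n ≤ C * N * Real.log N ^ (ρ / 2 - 1) := by
  obtain ⟨C, hC, hsum⟩ := exists_sum_pow_omega1_div_le hρ
  have h4 : 0 ≤ Real.log 4 := Real.log_nonneg (by norm_num)
  refine ⟨(3 * (ρ * (Real.log 4 + 4)) + 1) * C, by positivity, fun N hN ↦ ?_⟩
  have hlog : 0 < Real.log N := Real.log_pos (by exact_mod_cast (by omega : 1 < N))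
  have h := log_mul_sum_pow_omega1_le hρ (N := N) (by omega)
  rw [Real.rpow_sub_one hlog.ne', mul_div_assoc', le_div_iff₀ hlog, mul_comm _ (Real.log _)]
  refine h.trans ?_
  calc _ ≤ (3 * (ρ * (Real.log 4 + 4)) + 1) * N * (C * Real.log N ^ (ρ / 2)) := by
        gcongr; exact hsum N hN
    _ = _ := by ring

theorem exists_le_prod_one_add_rpow :
    ∃ c : ℝ, 0 < c ∧ ∀ σ : ℝ, 1 < σ → σ ≤ 2 → ∃ Q : Finset ℕ,
      (∀ p ∈ Q, p.Prime ∧ p % 4 = 1) ∧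
        c * (σ - 1) ^ (-(1 / 2) : ℝ) ≤ ∏ p ∈ Q, (1 + (p : ℝ) ^ (-σ)) := by
  obtain ⟨K, hK⟩ := exists_abs_primeSumOne_add_log_le
  have hZ : Summable fun n : ℕ ↦ (n : ℝ) ^ (-2 : ℝ) := Real.summable_nat_rpow.mpr (by norm_num)
  set Z := ∑' n : ℕ, (n : ℝ) ^ (-2 : ℝ)
  refine ⟨Real.exp (-K - 1 - Z), by positivity, fun σ hσ hσ2 ↦ ?_⟩
  obtain ⟨U, hU⟩ := ((summable_primeSumOne hσ).hasSum.eventually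
    (lt_mem_nhds (sub_one_lt (primeSumOne σ)))).exists
  set Q := (U.map ⟨fun q : Nat.Primes ↦ (q : ℕ), Nat.Primes.coe_nat_injective⟩).filter fun p ↦ p % 4 = 1 with hQ
  have hQmem : ∀ p ∈ Q, p.Prime ∧ p % 4 = 1 := by
    intro p hp
    rw [hQ, Finset.mem_filter, Finset.mem_map] at hp
    obtain ⟨⟨q, -, rfl⟩, h⟩ := hp
    exact ⟨q.2, h⟩
  have hQsum : primeSumOne σ - 1 < ∑ p ∈ Q, (p : ℝ) ^ (-σ) := by
    rw [hQ, Finset.sum_filter, Finset.sum_map]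
    exact hU
  have hsq : ∑ p ∈ Q, ((p : ℝ) ^ (-σ)) ^ 2 ≤ Z := by
    refine (Finset.sum_le_sum fun p hp ↦ ?_).trans (hZ.sum_le_tsum Q fun n _ ↦ by positivity)
    have hp1 : (1 : ℝ) ≤ p := by exact_mod_cast (hQmem p hp).1.one_le
    rw [← Real.rpow_natCast, ← Real.rpow_mul (by positivity)]
    exact Real.rpow_le_rpow_of_exponent_le hp1 (by push_cast; linarith)
  refine ⟨Q, hQmem, ?_⟩
  calc Real.exp (-K - 1 - Z) * (σ - 1) ^ (-(1 / 2) : ℝ)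
      = Real.exp (-K - 1 - Z + Real.log (σ - 1) * (-(1 / 2))) := by
        rw [Real.rpow_def_of_pos (by linarith), Real.exp_add]
    _ ≤ Real.exp (∑ p ∈ Q, ((p : ℝ) ^ (-σ) - ((p : ℝ) ^ (-σ)) ^ 2)) := by
        rw [Real.exp_le_exp, Finset.sum_sub_distrib]
        have := (abs_le.mp (hK σ hσ hσ2)).1
        linarith
    _ = ∏ p ∈ Q, Real.exp ((p : ℝ) ^ (-σ) - ((p : ℝ) ^ (-σ)) ^ 2) := Real.exp_sum _ _
    _ ≤ _ := by
        refine Finset.prod_le_prod (fun p _ ↦ by positivity) fun p _ ↦ ?_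
        have hu : 0 ≤ (p : ℝ) ^ (-σ) := by positivity
        set u := (p : ℝ) ^ (-σ)
        rw [← Real.le_log_iff_exp_le (by positivity)]
        refine le_trans ?_ (Real.one_sub_inv_le_log_of_pos (by positivity))
        rw [← sub_nonneg]
        have : 1 - (1 + u)⁻¹ - (u - u ^ 2) = u ^ 3 / (1 + u) := by field_simp; ring
        rw [this]
        positivity

theorem exists_prod_one_add_rpow_le :
    ∃ C : ℝ, 0 < C ∧ ∀ σ : ℝ, 1 < σ → σ ≤ 2 → ∀ Q : Finset ℕ, (∀ p ∈ Q, p.Prime ∧ p % 4 = 1) →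
      ∏ p ∈ Q, (1 + (p : ℝ) ^ (-σ)) ≤ C * (σ - 1) ^ (-(1 / 2) : ℝ) := by
  obtain ⟨K, hK⟩ := exists_abs_primeSumOne_add_log_le
  refine ⟨Real.exp (1 + K), by positivity, fun σ hσ hσ2 Q hQ ↦ ?_⟩
  have h := prod_one_add_le_exp le_rfl hσ Q fun p hp ↦
    ⟨(hQ p hp).1, by have := (hQ p hp).2; omega⟩
  simp only [ite_self, one_mul] at h
  refine h.trans ?_
  rw [Real.rpow_def_of_pos (by linarith), ← Real.exp_add, Real.exp_le_exp]
  have := (abs_le.mp (hK σ hσ hσ2)).2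
  linarith

theorem prod_one_add_rpow_le_sum_inv {δ : ℝ} (hδ : 0 < δ) {N : ℕ} (hN : N ≠ 0) (Q : Finset ℕ)
    (hQ : ∀ p ∈ Q, p.Prime ∧ p % 4 = 1) :
    ∏ p ∈ Q, (1 + (p : ℝ) ^ (-(1 + 2 * δ))) ≤
      ∑ m ∈ sosIcc N, 1 / (m : ℝ) +
        (N : ℝ) ^ (-δ) * ∏ p ∈ Q, (1 + (p : ℝ) ^ (-(1 + δ))) := by
  have hQt {t : Finset ℕ} (ht : t ∈ Q.powerset) : ∀ p ∈ t, p.Prime ∧ p % 4 = 1 :=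
    fun p hp ↦ hQ p (Finset.mem_powerset.mp ht hp)
  have hpos {t : Finset ℕ} (ht : t ∈ Q.powerset) : 1 ≤ ∏ p ∈ t, p :=
    Finset.prod_pos fun p hp ↦ (hQt ht p hp).1.pos
  have hsos {t : Finset ℕ} (ht : t ∈ Q.powerset) : ∏ p ∈ t, p ∈ SOS := by
    refine mem_SOS_of_forall_prime fun p hp hpt ↦ ?_
    obtain ⟨q, hq, hpq⟩ := (hp.prime.dvd_finsetProd_iff _).mp hpt
    rw [(Nat.prime_dvd_prime_iff_eq hp (hQt ht q hq).1).mp hpq, (hQt ht q hq).2]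
    norm_num
  have hexpand (σ : ℝ) : ∏ p ∈ Q, (1 + (p : ℝ) ^ (-σ)) =
      ∑ t ∈ Q.powerset, ((∏ p ∈ t, p : ℕ) : ℝ) ^ (-σ) := by
    rw [Finset.prod_one_add]
    refine Finset.sum_congr rfl fun t _ ↦ ?_
    push_cast
    exact Real.finsetProd_rpow _ _ (fun _ _ ↦ by positivity) _
  rw [hexpand, hexpand, Finset.mul_sum,
    ← Finset.sum_filter_add_sum_filter_not Q.powerset fun t ↦ ∏ p ∈ t, p ≤ N]
  refine add_le_add ?_ ?_
  · calc ∑ t ∈ Q.powerset with ∏ p ∈ t, p ≤ N, ((∏ p ∈ t, p : ℕ) : ℝ) ^ (-(1 + 2 * δ))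
        ≤ ∑ t ∈ Q.powerset with ∏ p ∈ t, p ≤ N, 1 / ((∏ p ∈ t, p : ℕ) : ℝ) := by
          refine Finset.sum_le_sum fun t ht ↦ ?_
          have h1 : (1 : ℝ) ≤ (∏ p ∈ t, p : ℕ) := by
            exact_mod_cast hpos (Finset.mem_filter.mp ht).1
          rw [one_div, ← Real.rpow_neg_one]
          exact Real.rpow_le_rpow_of_exponent_le h1 (by linarith)
      _ = ∑ m ∈ (Q.powerset.filter fun t ↦ ∏ p ∈ t, p ≤ N).image fun t ↦ ∏ p ∈ t, p,
            1 / (m : ℝ) := by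
          refine (Finset.sum_image (f := fun m : ℕ ↦ 1 / (m : ℝ)) fun t ht t' ht' h ↦ ?_).symm
          have ht := (Finset.mem_filter.mp ht).1
          have ht' := (Finset.mem_filter.mp ht').1
          rw [← Nat.primeFactors_prod fun p hp ↦ (hQt ht p hp).1,
            ← Nat.primeFactors_prod fun p hp ↦ (hQt ht' p hp).1]
          exact congrArg Nat.primeFactors h
      _ ≤ _ := by
          refine Finset.sum_le_sum_of_subset_of_nonneg (fun m hm ↦ ?_) fun m _ _ ↦ by positivity
          obtain ⟨t, ht, rfl⟩ := Finset.mem_image.mp hm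
          obtain ⟨ht, htN⟩ := Finset.mem_filter.mp ht
          exact mem_sosIcc.mpr ⟨hpos ht, htN, hsos ht⟩
  · refine (Finset.sum_le_sum fun t ht ↦ ?_).trans
      (Finset.sum_le_sum_of_subset_of_nonneg (Finset.filter_subset _ _) fun t _ _ ↦ by positivity)
    obtain ⟨ht, htN⟩ := Finset.mem_filter.mp ht
    have hNpos : (0 : ℝ) < N := by positivity
    have hle : (N : ℝ) ≤ (∏ p ∈ t, p : ℕ) := by exact_mod_cast (not_le.mp htN).le
    have hpos : (0 : ℝ) < (∏ p ∈ t, p : ℕ) := hNpos.trans_le hle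
    rw [show -(1 + 2 * δ) = -δ + -(1 + δ) by ring, Real.rpow_add hpos]
    exact mul_le_mul_of_nonneg_right
      (Real.rpow_le_rpow_of_nonpos hNpos hle (by linarith)) (by positivity)

/-- Lower bound for the logarithmic count of sums of two squares. -/
theorem exists_sqrt_log_le_sum_inv :
    ∃ c : ℝ, 0 < c ∧ ∀ᶠ N : ℕ in atTop,
      c * √(Real.log N) ≤ ∑ m ∈ sosIcc N, 1 / (m : ℝ) := by
  obtain ⟨c, hc, hlow⟩ := exists_le_prod_one_add_rpow
  obtain ⟨C, hC, hup⟩ := exists_prod_one_add_rpow_le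
  set b := c * (2 : ℝ) ^ (-(1 / 2) : ℝ) with hb
  have hb0 : 0 < b := by positivity
  obtain ⟨τ, hτ, hτ0⟩ : ∃ τ : ℝ, Real.exp (-τ) < b / 2 / C ∧ 0 < τ :=
    (((Real.tendsto_exp_neg_atTop_nhds_zero.eventually (gt_mem_nhds (by positivity))).and
      (eventually_gt_atTop 0))).exists
  have hτC : Real.exp (-τ) * C ≤ b / 2 := ((lt_div_iff₀ hC).mp hτ).le
  refine ⟨b / 2 * τ ^ (-(1 / 2) : ℝ), by positivity, ?_⟩
  filter_upwards [(Real.tendsto_log_atTop.comp tendsto_natCast_atTop_atTop).eventually_ge_atTop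
    (2 * τ), eventually_gt_atTop 1] with N hN hN1
  simp only [Function.comp_apply] at hN
  have hlog : 0 < Real.log N := by linarith
  set δ := τ / Real.log N with hδ
  have hδ0 : 0 < δ := by positivity
  have hδ1 : 2 * δ ≤ 1 := by
    rw [hδ, ← mul_div_assoc, div_le_one hlog]
    exact hN
  obtain ⟨Q, hQ, hQlow⟩ := hlow (1 + 2 * δ) (by linarith) (by linarith)
  have h1 := prod_one_add_rpow_le_sum_inv hδ0 (N := N) (by omega) Q hQ
  have h2 := hup (1 + δ) (by linarith) (by linarith) Q hQ
  rw [add_sub_cancel_left, Real.mul_rpow (by norm_num) hδ0.le, ← mul_assoc, ← hb] at hQlow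
  rw [add_sub_cancel_left] at h2
  have hNδ : (N : ℝ) ^ (-δ) = Real.exp (-τ) := by
    rw [Real.rpow_def_of_pos (by positivity), hδ]
    congr 1
    field_simp
  rw [hNδ] at h1
  have h3 : Real.exp (-τ) * ∏ p ∈ Q, (1 + (p : ℝ) ^ (-(1 + δ))) ≤
      b / 2 * δ ^ (-(1 / 2) : ℝ) := by
    refine (mul_le_mul_of_nonneg_left h2 (by positivity)).trans ?_
    rw [← mul_assoc]
    exact mul_le_mul_of_nonneg_right hτC (by positivity)
  have h4 : δ ^ (-(1 / 2) : ℝ) = τ ^ (-(1 / 2) : ℝ) * √(Real.log N) := by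
    rw [hδ, Real.div_rpow hτ0.le hlog.le, Real.rpow_neg hlog.le, div_inv_eq_mul, Real.sqrt_eq_rpow]
  rw [h4] at hQlow h3
  linarith

/-- The primes up to `y` congruent to `1` mod `4`. -/
def primesOne (y : ℕ) : Finset ℕ := (Finset.Icc 1 y).filter fun p ↦ p.Prime ∧ p % 4 = 1

theorem mem_primesOne {y p : ℕ} : p ∈ primesOne y ↔ p ≤ y ∧ p.Prime ∧ p % 4 = 1 := by
  rw [primesOne, Finset.mem_filter, Finset.mem_Icc]
  exact ⟨fun h ↦ ⟨h.1.2, h.2⟩, fun h ↦ ⟨⟨h.2.1.one_le, h.1⟩, h.2⟩⟩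

theorem primesOne_subset {x y : ℕ} (h : x ≤ y) : primesOne x ⊆ primesOne y := fun p hp ↦ by
  rw [mem_primesOne] at hp ⊢
  exact ⟨hp.1.trans h, hp.2⟩

theorem primeCounting_floor_le {x : ℝ} (hx : 1 < x) :
    (Nat.primeCounting ⌊x⌋₊ : ℝ) ≤ (2 * Real.log 4 + 2) * (x / Real.log x) := by
  have hlog : 0 < Real.log x := Real.log_pos hx
  have h := Chebyshev.pi_le_log4_mul_div hx
  have hs : Real.log √x = Real.log x / 2 := Real.log_sqrt (by linarith)
  have h2 : Real.log √x ≤ √x := Real.log_le_self (Real.sqrt_nonneg x)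
  have h3 : √x ≤ 2 * (x / Real.log x) := by
    rw [mul_div_assoc', le_div_iff₀ hlog]
    nlinarith [Real.mul_self_sqrt (show 0 ≤ x by linarith), Real.sqrt_nonneg x]
  rw [hs] at h
  calc _ ≤ _ := h
    _ ≤ Real.log 4 * x / (Real.log x / 2) + 2 * (x / Real.log x) := by linarith
    _ = _ := by field_simp

theorem card_primesOne_le_primeCounting (y : ℕ) : (primesOne y).card ≤ Nat.primeCounting y := by
  rw [← Nat.primesLE_card_eq_primeCounting]
  refine Finset.card_le_card fun p hp ↦ ?_
  obtain ⟨h1, h2, -⟩ := mem_primesOne.mp hp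
  exact Nat.mem_primesLE.mpr ⟨h1, h2⟩

theorem exists_card_primesOne_div_le :
    ∃ B : ℝ, 0 < B ∧ ∀ y s : ℕ, s ≠ 0 →
      ((primesOne (y / s ^ 2)).card : ℝ) ≤ (y / Real.log y) * (B * (s : ℝ) ^ (-(3 / 2) : ℝ)) := by
  have hlog2 : 0 < Real.log 2 := Real.log_pos one_lt_two
  have hlog4 : 0 < Real.log 4 := Real.log_pos (by norm_num)
  refine ⟨(2 * Real.log 4 + 2) * (1 + 4 / Real.log 2), by positivity, fun y s hs ↦ ?_⟩
  have hlogy : 0 ≤ Real.log y := Real.log_natCast_nonneg y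
  rcases (primesOne (y / s ^ 2)).eq_empty_or_nonempty with h | ⟨p, hp⟩
  · rw [h, Finset.card_empty, Nat.cast_zero]
    positivity
  have hs1 : (1 : ℝ) ≤ s := by exact_mod_cast Nat.one_le_iff_ne_zero.mpr hs
  set t : ℝ := (y : ℝ) / (s : ℝ) ^ 2 with ht
  have hfloor : ⌊t⌋₊ = y / s ^ 2 := by
    rw [ht, ← Nat.cast_pow, Nat.floor_div_natCast, Nat.floor_natCast]
  have ht2 : 2 ≤ t := by
    have h2 : 2 ≤ ⌊t⌋₊ := by
      rw [hfloor]
      exact (mem_primesOne.mp hp).2.1.two_le.trans (mem_primesOne.mp hp).1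
    exact_mod_cast (Nat.le_floor_iff (by positivity)).mp h2
  have hlogt : Real.log 2 ≤ Real.log t := Real.log_le_log two_pos ht2
  have hlogt0 : 0 < Real.log t := by linarith
  have hyt : (y : ℝ) = t * (s : ℝ) ^ 2 := by rw [ht]; field_simp
  have hy : Real.log y = Real.log t + 2 * Real.log s := by
    rw [hyt, Real.log_mul (by positivity) (by positivity), Real.log_pow]
    norm_num
  have hlogs : 0 ≤ Real.log s := Real.log_nonneg hs1
  have hlogs2 : Real.log s ≤ 2 * √s := by
    have h1 : Real.log √s = Real.log s / 2 := Real.log_sqrt (by positivity)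
    have h2 := Real.log_le_self (Real.sqrt_nonneg (s : ℝ))
    linarith
  have hsqrt : 1 ≤ √(s : ℝ) := Real.one_le_sqrt.mpr hs1
  have hkey : Real.log y ≤ Real.log t * ((1 + 4 / Real.log 2) * √s) := by
    calc Real.log y ≤ Real.log t + Real.log t / Real.log 2 * (2 * Real.log s) := by
          rw [hy]
          refine add_le_add_right (le_mul_of_one_le_left (mul_nonneg zero_le_two hlogs) ?_) _
          rwa [one_le_div hlog2]
      _ ≤ Real.log t * √s + Real.log t / Real.log 2 * (2 * (2 * √s)) := by
          gcongr
          exact le_mul_of_one_le_right hlogt0.le hsqrt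
      _ = _ := by ring
  have hpow : (s : ℝ) ^ (-(3 / 2) : ℝ) = √s / (s : ℝ) ^ 2 := by
    rw [Real.sqrt_eq_rpow, ← Real.rpow_natCast, ← Real.rpow_sub (by positivity)]
    norm_num
  calc ((primesOne (y / s ^ 2)).card : ℝ) ≤ Nat.primeCounting ⌊t⌋₊ := by
        rw [hfloor]; exact_mod_cast card_primesOne_le_primeCounting _
    _ ≤ (2 * Real.log 4 + 2) * (t / Real.log t) := primeCounting_floor_le (by linarith)
    _ ≤ (2 * Real.log 4 + 2) * (t * ((1 + 4 / Real.log 2) * √s) / Real.log y) := by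
        refine mul_le_mul_of_nonneg_left ?_ (by positivity)
        rw [div_le_div_iff₀ hlogt0 (by linarith), mul_assoc, mul_comm _ (Real.log t)]
        gcongr
    _ = _ := by rw [hpow, ht]; ring

theorem card_filter_omega1_eq_one_le (y : ℕ) :
    ((sosIcc y).filter (omega1 · = 1)).card ≤
      2 * (Nat.sqrt y + ∑ s ∈ Finset.Icc 1 (Nat.sqrt y), (primesOne (y / s ^ 2)).card) := by
  calc ((sosIcc y).filter (omega1 · = 1)).card
      ≤ (({1, 2} : Finset ℕ) ×ˢ (Finset.Icc 1 (Nat.sqrt y)).sigma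
          fun s ↦ insert 1 (primesOne (y / s ^ 2))).card := by
        refine (Finset.card_le_card fun n hn ↦ ?_).trans
          (Finset.card_image_le (f := fun x : ℕ × (_ : ℕ) × ℕ ↦ x.2.1 ^ 2 * (x.1 * x.2.2)))
        rw [Finset.mem_filter] at hn
        obtain ⟨hn, hω⟩ := hn
        obtain ⟨hn1, hny, hnS⟩ := mem_sosIcc.mp hn
        obtain ⟨s, b, rfl, hsq, hb⟩ := exists_eq_sq_mul_of_mem_SOS hnS (by omega)
        have hs0 : s ≠ 0 := by rintro rfl; simp at hn1
        set c := ∏ p ∈ b.primeFactors with ¬ p % 4 = 1, p with hc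
        set q := ∏ p ∈ b.primeFactors with p % 4 = 1, p with hq
        have hbcq : c * q = b := by
          rw [mul_comm, Finset.prod_filter_mul_prod_filter_not,
            Nat.prod_primeFactors_of_squarefree hsq]
        have hc2 : c ∈ ({1, 2} : Finset ℕ) := by
          have hsub : (b.primeFactors.filter fun p ↦ ¬ p % 4 = 1) ⊆ {2} := fun p hp ↦ by
            obtain ⟨hp, hp1⟩ := Finset.mem_filter.mp hp
            have hpp := Nat.prime_of_mem_primeFactors hp
            have := hb p hpp (Nat.dvd_of_mem_primeFactors hp)
            rcases hpp.eq_two_or_odd with h | h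
            · exact Finset.mem_singleton.mpr h
            · omega
          rcases Finset.subset_singleton_iff.mp hsub with h | h <;> simp [hc, h]
        obtain ⟨p, hp⟩ := Finset.card_eq_one.mp hω
        have hpp : p.Prime ∧ p % 4 = 1 := by
          have := Finset.mem_filter.mp (hp ▸ Finset.mem_singleton_self p)
          exact ⟨Nat.prime_of_mem_primeFactors this.1, this.2⟩
        have hqp : q = 1 ∨ q = p := by
          have hsub : (b.primeFactors.filter fun p ↦ p % 4 = 1) ⊆ {p} := by
            rw [← hp]
            exact Finset.filter_subset_filter _
              (Nat.primeFactors_mono (Dvd.intro_left _ rfl) (by positivity))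
          rcases Finset.subset_singleton_iff.mp hsub with h | h <;> simp [hq, h]
        have hsy : s ^ 2 * q ≤ y := by
          refine le_trans ?_ hny
          rw [← hbcq, mul_left_comm]
          refine Nat.le_mul_of_pos_left _ (Nat.pos_of_ne_zero ?_)
          rintro hc0
          rw [hc0, zero_mul] at hbcq
          exact hsq.ne_zero hbcq.symm
        have hq0 : 0 < q := by rcases hqp with h | h <;> rw [h]; exacts [one_pos, hpp.1.pos]
        refine Finset.mem_image.mpr ⟨(c, ⟨s, q⟩), ?_, by simp only [hbcq]⟩
        rw [Finset.mem_product, Finset.mem_sigma, Finset.mem_Icc, Nat.le_sqrt',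
          Finset.mem_insert (s := primesOne _), mem_primesOne, Nat.le_div_iff_mul_le (by positivity), mul_comm]
        refine ⟨hc2, ⟨Nat.pos_of_ne_zero hs0, (Nat.le_mul_of_pos_right _ hq0).trans hsy⟩, ?_⟩
        exact hqp.imp_right fun h : q = p ↦ ⟨hsy, h ▸ hpp⟩
    _ = 2 * ∑ s ∈ Finset.Icc 1 (Nat.sqrt y), (insert 1 (primesOne (y / s ^ 2))).card := by
        rw [Finset.card_product, Finset.card_sigma]
        rfl
    _ ≤ 2 * ∑ s ∈ Finset.Icc 1 (Nat.sqrt y), (1 + (primesOne (y / s ^ 2)).card) := by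
        gcongr with s
        rw [add_comm]
        exact Finset.card_insert_le _ _
    _ = _ := by
        rw [Finset.sum_add_distrib, Finset.sum_const, Nat.card_Icc]
        simp

theorem SatheSelberg.exists_le_card_filter (h : SatheSelberg) :
    ∃ c : ℝ, 0 < c ∧ ∀ᶠ y : ℕ in atTop,
      c * (y / Real.log y) ≤ ((sosIcc y).filter (omega1 · = 1)).card := by
  obtain ⟨C₀, C, hC₀, hC, h⟩ := h
  obtain ⟨y₀, h⟩ := h (C₀ / 2) (by positivity)
  have hlim : Tendsto (fun y : ℕ ↦ C * Real.log (Real.log y)) atTop atTop :=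
    (Real.tendsto_log_atTop.comp
      (Real.tendsto_log_atTop.comp tendsto_natCast_atTop_atTop)).const_mul_atTop hC
  refine ⟨C₀ / 2, by positivity, ?_⟩
  filter_upwards [eventually_ge_atTop y₀, hlim.eventually_ge_atTop 1] with y hy hy1
  have hcard : Nat.card {n : ℕ // n ∈ SOS ∧ n ≤ y ∧ omega1 n = 1} =
      ((sosIcc y).filter (omega1 · = 1)).card := by
    refine Nat.subtype_card _ fun n ↦ ?_
    rw [Finset.mem_filter, mem_sosIcc]
    refine ⟨fun hn ↦ ⟨hn.1.2.2, hn.1.2.1, hn.2⟩,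
      fun hn ↦ ⟨⟨Nat.pos_of_ne_zero ?_, hn.2.1, hn.1⟩, hn.2.2⟩⟩
    rintro rfl
    simp [omega1] at hn
  have h1 := h y hy 1 le_rfl (by exact_mod_cast hy1)
  rw [hcard] at h1
  simp only [le_refl, tsub_eq_zero_of_le, pow_zero, mul_one, Nat.factorial_zero, Nat.cast_one,
    div_one] at h1
  linarith [(abs_le.mp h1).1]

/-- Under the Sathe–Selberg analogue, the primes congruent to `1` mod `4` satisfy a lower bound of
Chebyshev type. -/
theorem SatheSelberg.exists_le_card_primesOne (h : SatheSelberg) :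
    ∃ c : ℝ, 0 < c ∧ ∀ᶠ y : ℕ in atTop, c * (y / Real.log y) ≤ (primesOne y).card := by
  obtain ⟨c, hc, hlow⟩ := h.exists_le_card_filter
  obtain ⟨B, hB, hup⟩ := exists_card_primesOne_div_le
  have hsum : Summable fun s : ℕ ↦ B * (s : ℝ) ^ (-(3 / 2) : ℝ) :=
    (Real.summable_nat_rpow.mpr (by norm_num)).mul_left B
  obtain ⟨F, hF⟩ := summable_iff_vanishing_norm.mp hsum (c / 8) (by positivity)
  have hsqrt : ∀ᶠ y : ℕ in atTop, Real.log y ≤ c / 8 * √y := by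
    have := (isLittleO_log_rpow_atTop (show (0 : ℝ) < 1 / 2 by norm_num)).bound
      (show 0 < c / 8 by positivity)
    filter_upwards [tendsto_natCast_atTop_atTop.eventually this] with y hy
    rw [Real.norm_of_nonneg (Real.log_natCast_nonneg y), Real.norm_of_nonneg (by positivity),
      ← Real.sqrt_eq_rpow] at hy
    exact hy
  refine ⟨c / 4 / (F.card + 1), by positivity, ?_⟩
  filter_upwards [hlow, hsqrt, eventually_gt_atTop 1] with y hy hys hy1
  have hlog : 0 < Real.log y := Real.log_pos (by exact_mod_cast hy1)
  set A : ℝ := y / Real.log y with hA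
  have hA0 : 0 < A := by positivity
  have h1 : (Nat.sqrt y : ℝ) ≤ c / 8 * A := by
    refine (Real.nat_sqrt_le_real_sqrt).trans ?_
    rw [hA, mul_div_assoc', le_div_iff₀ hlog]
    nlinarith [Real.mul_self_sqrt (Nat.cast_nonneg (α := ℝ) y), Real.sqrt_nonneg (y : ℝ)]
  have h2 : ∑ s ∈ Finset.Icc 1 (Nat.sqrt y), ((primesOne (y / s ^ 2)).card : ℝ) ≤
      F.card * (primesOne y).card + A * (c / 8) := by
    rw [← Finset.sum_filter_add_sum_filter_not _ (· ∈ F)]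
    refine add_le_add ?_ ?_
    · calc _ ≤ ∑ s ∈ (Finset.Icc 1 (Nat.sqrt y)).filter (· ∈ F), ((primesOne y).card : ℝ) := by
            gcongr
            exact primesOne_subset (Nat.div_le_self _ _)
        _ ≤ _ := by
            rw [Finset.sum_const, nsmul_eq_mul]
            gcongr
            exact fun s hs ↦ (Finset.mem_filter.mp hs).2
    · calc _ ≤ ∑ s ∈ (Finset.Icc 1 (Nat.sqrt y)).filter (· ∉ F),
              A * (B * (s : ℝ) ^ (-(3 / 2) : ℝ)) := by
            refine Finset.sum_le_sum fun s hs ↦ hup y s ?_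
            have := (Finset.mem_Icc.mp (Finset.mem_filter.mp hs).1).1
            omega
        _ ≤ _ := by
            rw [← Finset.mul_sum]
            gcongr
            refine (Real.le_norm_self _).trans (hF _ ?_).le
            exact Finset.disjoint_left.mpr fun s hs ↦ (Finset.mem_filter.mp hs).2
  have h3 : (((sosIcc y).filter (omega1 · = 1)).card : ℝ) ≤
      2 * (Nat.sqrt y + ∑ s ∈ Finset.Icc 1 (Nat.sqrt y), ((primesOne (y / s ^ 2)).card : ℝ)) := by
    exact_mod_cast card_filter_omega1_eq_one_le y
  rw [div_mul_eq_mul_div, div_le_iff₀ (by positivity)]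
  nlinarith [Nat.cast_nonneg (α := ℝ) (primesOne y).card]

theorem tendsto_sqrt_sqrt_atTop : Tendsto (fun x ↦ Nat.sqrt (Nat.sqrt x)) atTop atTop := by
  refine tendsto_atTop.mpr fun b ↦ ?_
  filter_upwards [eventually_ge_atTop (b ^ 4)] with x hx
  rw [Nat.le_sqrt', Nat.le_sqrt', ← pow_mul]
  exact hx

theorem sum_card_primesOne_sdiff_le {x M r : ℕ} (hMr : M ≤ r) :
    ∑ m ∈ sosIcc M, (primesOne (x / m) \ primesOne r).card ≤ (sosIcc x).card := by
  rw [← Finset.card_sigma]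
  have hmem {a : (_ : ℕ) × ℕ}
      (ha : a ∈ (sosIcc M).sigma fun m ↦ primesOne (x / m) \ primesOne r) :
      a.1 ∈ sosIcc M ∧ a.2 ≤ x / a.1 ∧ a.2.Prime ∧ a.2 % 4 = 1 ∧ r < a.2 := by
    rw [Finset.mem_sigma, Finset.mem_sdiff, mem_primesOne, mem_primesOne] at ha
    obtain ⟨h1, ⟨h2, h3, h4⟩, h5⟩ := ha
    exact ⟨h1, h2, h3, h4, by_contra fun h ↦ h5 ⟨not_lt.mp h, h3, h4⟩⟩
  refine Finset.card_le_card_of_injOn (fun a ↦ a.1 * a.2) (fun a ha ↦ ?_) fun a ha b hb hab ↦ ?_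
  · obtain ⟨h1, h2, h3, h4, -⟩ := hmem ha
    obtain ⟨h5, -, h6⟩ := mem_sosIcc.mp h1
    refine mem_sosIcc.mpr ⟨Nat.mul_pos h5 h3.pos, ?_, mul_mem_SOS h6 (prime_mem_SOS h3 h4)⟩
    change a.1 * a.2 ≤ x
    rw [mul_comm]
    exact (Nat.le_div_iff_mul_le h5).mp h2
  · obtain ⟨h1, -, h2, -, h3⟩ := hmem ha
    obtain ⟨h4, -, h5, -, -⟩ := hmem hb
    obtain ⟨m, p⟩ := a
    obtain ⟨m', p'⟩ := b
    dsimp only at *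
    obtain ⟨h6, h7, -⟩ := mem_sosIcc.mp h4
    have hp : p = p' := by
      rcases (Nat.Prime.dvd_mul h2).mp (Dvd.intro_left m hab) with h | h
      · have := Nat.le_of_dvd h6 h
        omega
      · exact (Nat.prime_dvd_prime_iff_eq h2 h5).mp h
    subst hp
    rw [Nat.eq_of_mul_eq_mul_right h2.pos hab]

/-- Lower bound for the number of sums of two squares up to `x`. -/
theorem SatheSelberg.exists_le_card_sosIcc (h : SatheSelberg) :
    ∃ c : ℝ, 0 < c ∧ ∀ᶠ x : ℕ in atTop, c * (x / √(Real.log x)) ≤ (sosIcc x).card := by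
  obtain ⟨c, hc, hprimes⟩ := h.exists_le_card_primesOne
  obtain ⟨y₀, hprimes⟩ := eventually_atTop.mp hprimes
  obtain ⟨d, hd, hsum⟩ := exists_sqrt_log_le_sum_inv
  have hlogx : ∀ᶠ x : ℕ in atTop, Real.log x ≤ c / 4 * (x : ℝ) ^ (1 / 4 : ℝ) := by
    have := (isLittleO_log_rpow_atTop (show (0 : ℝ) < 1 / 4 by norm_num)).bound
      (show 0 < c / 4 by positivity)
    filter_upwards [tendsto_natCast_atTop_atTop.eventually this] with x hx
    rwa [Real.norm_of_nonneg (Real.log_natCast_nonneg x), Real.norm_of_nonneg (by positivity)]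
      at hx
  refine ⟨c / 4 * d / 3, by positivity, ?_⟩
  filter_upwards [hlogx, tendsto_sqrt_sqrt_atTop.eventually hsum,
    tendsto_sqrt_sqrt_atTop.eventually_ge_atTop (y₀ + 2)] with x hx hsumM hM
  set r := Nat.sqrt x with hr
  set M := Nat.sqrt r with hM'
  have hMr : M ^ 2 ≤ r := Nat.sqrt_le' r
  have hrx : r ^ 2 ≤ x := Nat.sqrt_le' x
  have hMler : M ≤ r := (Nat.le_self_pow two_ne_zero M).trans hMr
  have hM4 : M ^ 4 ≤ x := by
    calc M ^ 4 = (M ^ 2) ^ 2 := by ring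
      _ ≤ r ^ 2 := by gcongr
      _ ≤ x := hrx
  have hxM : x ≤ M ^ 9 := by
    have h1 : r + 1 ≤ (M + 1) ^ 2 := Nat.lt_succ_sqrt' r
    have h2 : x + 1 ≤ (r + 1) ^ 2 := Nat.lt_succ_sqrt' x
    calc x ≤ (r + 1) ^ 2 := by omega
      _ ≤ ((M + 1) ^ 2) ^ 2 := by gcongr
      _ ≤ ((M ^ 2) ^ 2) ^ 2 := by gcongr; nlinarith
      _ = M ^ 8 := by ring
      _ ≤ M ^ 9 := Nat.pow_le_pow_right (by omega) (by norm_num)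
  have hx2 : 2 ≤ x := by
    calc 2 ≤ M := by omega
      _ ≤ M ^ 4 := Nat.le_self_pow (by norm_num) M
      _ ≤ x := hM4
  have hx0 : (0 : ℝ) < x := by positivity
  have hlog : 0 < Real.log x := Real.log_pos (by exact_mod_cast hx2)
  have hlogM : √(Real.log x) ≤ 3 * √(Real.log M) := by
    rw [Real.sqrt_le_left (by positivity), mul_pow, Real.sq_sqrt (Real.log_natCast_nonneg M)]
    have : Real.log x ≤ Real.log ((M : ℝ) ^ 9) := Real.log_le_log hx0 (by exact_mod_cast hxM)
    rw [Real.log_pow] at this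
    norm_num at this ⊢
    exact this
  have hcount (m : ℕ) (hm : m ∈ sosIcc M) : c / 4 * (x / Real.log x) * (1 / (m : ℝ)) ≤
      (primesOne (x / m) \ primesOne r).card := by
    obtain ⟨hm1, hmM, -⟩ := mem_sosIcc.mp hm
    have hm0 : (0 : ℝ) < m := by exact_mod_cast hm1
    have hMxm : M ≤ x / m := by
      rw [Nat.le_div_iff_mul_le hm1]
      calc M * m ≤ M * M := by gcongr
        _ = M ^ 2 := by ring
        _ ≤ M ^ 4 := Nat.pow_le_pow_right (by omega) (by norm_num)
        _ ≤ x := hM4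
    have h1 := hprimes (x / m) (by omega)
    set y := x / m with hy
    have hy1 : 1 < y := by omega
    have hylog : 0 < Real.log y := Real.log_pos (by exact_mod_cast hy1)
    have hxy : (x : ℝ) / m ≤ 2 * y := by
      rw [div_le_iff₀ hm0]
      have h2 : x < (y + 1) * m := Nat.lt_mul_of_div_lt (Nat.lt_succ_self _) hm1
      have h3 : x ≤ 2 * y * m := h2.le.trans (by gcongr; omega)
      exact_mod_cast h3
    have hlogle : Real.log y ≤ Real.log x :=
      Real.log_le_log (by positivity) (by exact_mod_cast Nat.div_le_self x m)
    have h2 : c / 2 * (x / Real.log x) * (1 / (m : ℝ)) ≤ (primesOne y).card := by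
      refine le_trans ?_ h1
      calc c / 2 * (x / Real.log x) * (1 / (m : ℝ)) = c / 2 * ((x : ℝ) / m / Real.log x) := by
            ring
        _ ≤ c / 2 * (2 * y / Real.log y) := by gcongr
        _ = _ := by ring
    have h3 : ((primesOne r).card : ℝ) ≤ c / 4 * (x / Real.log x) * (1 / (m : ℝ)) := by
      have hrm : (r : ℝ) ≤ (x : ℝ) ^ (1 / 2 : ℝ) := by
        rw [← Real.sqrt_eq_rpow]; exact Real.nat_sqrt_le_real_sqrt
      have hmx : (m : ℝ) ≤ (x : ℝ) ^ (1 / 4 : ℝ) := by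
        rw [one_div, Real.le_rpow_inv_iff_of_pos hm0.le hx0.le (by norm_num)]
        exact_mod_cast (Nat.pow_le_pow_left hmM 4).trans hM4
      have hcard : ((primesOne r).card : ℝ) ≤ r := by
        exact_mod_cast (Finset.card_filter_le _ _).trans (by simp)
      refine hcard.trans ?_
      rw [mul_one_div, mul_div_assoc', div_div, le_div_iff₀ (by positivity)]
      calc (r : ℝ) * (Real.log x * m)
          ≤ (x : ℝ) ^ (1 / 2 : ℝ) * (c / 4 * (x : ℝ) ^ (1 / 4 : ℝ) * (x : ℝ) ^ (1 / 4 : ℝ)) := by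
            gcongr
        _ = c / 4 * ((x : ℝ) ^ (1 / 2 : ℝ) * (x : ℝ) ^ (1 / 4 : ℝ) * (x : ℝ) ^ (1 / 4 : ℝ)) := by
            ring
        _ = c / 4 * x := by
            rw [← Real.rpow_add hx0, ← Real.rpow_add hx0]
            norm_num
    have h4 : ((primesOne y).card : ℝ) ≤ (primesOne y \ primesOne r).card + (primesOne r).card := by
      exact_mod_cast Finset.card_le_card_sdiff_add_card
    linarith
  calc c / 4 * d / 3 * (x / √(Real.log x))
      = c / 4 * (x / Real.log x) * (d * (√(Real.log x) / 3)) := by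
        have : Real.log x = √(Real.log x) * √(Real.log x) := (Real.mul_self_sqrt hlog.le).symm
        have h0 : 0 < √(Real.log x) := Real.sqrt_pos.mpr hlog
        nth_rw 2 [this]
        field_simp
    _ ≤ c / 4 * (x / Real.log x) * (d * √(Real.log M)) := by
        gcongr
        linarith
    _ ≤ c / 4 * (x / Real.log x) * ∑ m ∈ sosIcc M, 1 / (m : ℝ) := by gcongr
    _ ≤ ∑ m ∈ sosIcc M, ((primesOne (x / m) \ primesOne r).card : ℝ) := by
        rw [Finset.mul_sum]
        exact Finset.sum_le_sum hcount
    _ ≤ _ := by exact_mod_cast sum_card_primesOne_sdiff_le hMler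

theorem betweenCount_eq_card (m n : ℕ) [DecidablePred (· ∈ SOS)] :
    betweenCount m n = ((Finset.Ioo (min m n) (max m n)).filter (· ∈ SOS)).card :=
  Nat.subtype_card _ fun k ↦ by
    rw [Finset.mem_filter, Finset.mem_Ioo, and_comm]

theorem card_le_betweenCount {m n : ℕ} (U : Finset ℕ)
    (hU : ∀ k ∈ U, k ∈ SOS ∧ min m n < k ∧ k < max m n) : U.card ≤ betweenCount m n := by
  classical
  rw [betweenCount_eq_card]
  exact Finset.card_le_card fun k hk ↦
    Finset.mem_filter.mpr ⟨Finset.mem_Ioo.mpr (hU k hk).2, (hU k hk).1⟩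

/-- Few sums of two squares are separated from `n` by fewer than `B` others. -/
theorem card_le_of_betweenCount_lt {n : ℕ} {B : ℝ} (hB : 0 ≤ B) (T : Finset ℕ)
    (hT : ∀ m ∈ T, m ∈ SOS ∧ (betweenCount m n : ℝ) < B) : (T.card : ℝ) ≤ 2 * B + 3 := by
  have hside (U : Finset ℕ) (hUT : U ⊆ T)
      (hU : U.Nonempty → ∃ m ∈ U, ∀ k ∈ U.erase m, min m n < k ∧ k < max m n) :
      (U.card : ℝ) ≤ B + 1 := by
    rcases U.eq_empty_or_nonempty with rfl | hne
    · simpa using by linarith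
    · obtain ⟨m, hm, hk⟩ := hU hne
      have h1 : U.card - 1 ≤ betweenCount m n := by
        rw [← Finset.card_erase_of_mem hm]
        exact card_le_betweenCount _ fun k hkU ↦
          ⟨(hT k (hUT (Finset.mem_of_mem_erase hkU))).1, hk k hkU⟩
      have h2 : (U.card : ℝ) ≤ betweenCount m n + 1 := by exact_mod_cast (by omega)
      linarith [(hT m (hUT hm)).2]
  have hlt : ((T.filter (· < n)).card : ℝ) ≤ B + 1 := by
    refine hside _ (Finset.filter_subset _ _) fun hne ↦ ⟨_, Finset.min'_mem _ hne, fun k hk ↦ ?_⟩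
    have h1 := Finset.min'_lt_of_mem_erase_min' _ hne hk
    have h2 := (Finset.mem_filter.mp (Finset.mem_of_mem_erase hk)).2
    exact ⟨(min_le_left _ _).trans_lt h1, h2.trans_le (le_max_right _ _)⟩
  have hgt : ((T.filter (n < ·)).card : ℝ) ≤ B + 1 := by
    refine hside _ (Finset.filter_subset _ _) fun hne ↦ ⟨_, Finset.max'_mem _ hne, fun k hk ↦ ?_⟩
    have h1 := Finset.lt_max'_of_mem_erase_max' _ hne hk
    have h2 := (Finset.mem_filter.mp (Finset.mem_of_mem_erase hk)).2
    exact ⟨(min_le_right _ _).trans_lt h2, h1.trans_le (le_max_left _ _)⟩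
  have hT' : T ⊆ insert n (T.filter (· < n) ∪ T.filter (n < ·)) := fun m hm ↦ by
    rcases lt_trichotomy m n with h | h | h <;> simp [h, hm]
  have hcard : T.card ≤ (T.filter (· < n)).card + (T.filter (n < ·)).card + 1 :=
    (Finset.card_le_card hT').trans ((Finset.card_insert_le _ _).trans
      (by gcongr; exact Finset.card_union_le _ _))
  have hcard' : (T.card : ℝ) ≤ (T.filter (· < n)).card + (T.filter (n < ·)).card + 1 := by
    exact_mod_cast hcard
  linarith

theorem sqrt_le_betweenCount {m n x : ℕ} (hm : m ≤ x) (hn : 4 * x < n) :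
    √(n : ℝ) / 2 - 1 ≤ betweenCount m n := by
  have hmn : m < n := by omega
  have hcard : Nat.sqrt (n - 1) - Nat.sqrt m ≤ betweenCount m n := by
    rw [← Nat.card_Ioc, ← Finset.card_image_of_injective _ (Nat.pow_left_injective two_ne_zero)]
    refine card_le_betweenCount _ fun k hk ↦ ?_
    obtain ⟨j, hj, rfl⟩ := Finset.mem_image.mp hk
    obtain ⟨h1, h2⟩ := Finset.mem_Ioc.mp hj
    rw [Nat.sqrt_lt'] at h1
    rw [Nat.le_sqrt'] at h2
    refine ⟨sq_mem_SOS j, ?_, ?_⟩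
    · rwa [min_eq_left hmn.le]
    · rw [max_eq_right hmn.le]
      omega
  have h1 : √(n : ℝ) ≤ Nat.sqrt (n - 1) + 1 := by
    rw [Real.sqrt_le_left (by positivity)]
    have : n - 1 < (Nat.sqrt (n - 1) + 1) ^ 2 := Nat.lt_succ_sqrt' (n - 1)
    exact_mod_cast (by omega : n ≤ (Nat.sqrt (n - 1) + 1) ^ 2)
  have h2 : (Nat.sqrt m : ℝ) ≤ √(n : ℝ) / 2 := by
    refine Real.nat_sqrt_le_real_sqrt.trans ?_
    rw [Real.sqrt_le_left (by positivity), div_pow, Real.sq_sqrt (by positivity)]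
    have : ((4 * m : ℕ) : ℝ) ≤ n := by exact_mod_cast (by omega)
    push_cast at this
    linarith
  have h3 : (Nat.sqrt (n - 1) : ℝ) ≤ betweenCount m n + Nat.sqrt m := by
    exact_mod_cast (by omega)
  linarith

/-- The weight `ρ ^ ω₁(n) (log n) ^ (-(ρ log ρ) / 2)`. -/
def omegaWeight (ρ : ℝ) (n : ℕ) : ℝ :=
  ρ ^ omega1 n * Real.log n ^ (-(ρ / 2 * Real.log ρ))

theorem omegaWeight_nonneg {ρ : ℝ} (hρ : 1 ≤ ρ) (n : ℕ) : 0 ≤ omegaWeight ρ n := by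
  have := Real.log_natCast_nonneg n
  rw [omegaWeight]
  positivity

theorem one_lt_log_natCast {n : ℕ} (hn : 3 ≤ n) : 1 < Real.log n := by
  have h : (3 : ℝ) ≤ n := by exact_mod_cast hn
  rw [Real.lt_log_iff_exp_lt (by linarith)]
  linarith [Real.exp_one_lt_d9]

theorem omegaWeight_le {ρ : ℝ} (hρ : 1 ≤ ρ) {n : ℕ} (hn : 3 ≤ n) :
    omegaWeight ρ n ≤ ρ ^ omega1 n := by
  have : 0 ≤ Real.log ρ := Real.log_nonneg hρ
  refine mul_le_of_le_one_right (by positivity)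
    (Real.rpow_le_one_of_one_le_of_nonpos (one_lt_log_natCast hn).le ?_)
  rw [neg_nonpos]
  positivity

theorem pow_le_omegaWeight {ρ : ℝ} (hρ : 1 ≤ ρ) {n i : ℕ} (hn : 3 ≤ n)
    (h : (2 : ℝ) ^ i * Real.log n ^ (ρ / 2 * Real.log 2) ≤ 2 ^ omega1 n) :
    ρ ^ i ≤ omegaWeight ρ n := by
  have hlog : 0 < Real.log n := zero_lt_one.trans (one_lt_log_natCast hn)
  have hlog2 : 0 < Real.log 2 := Real.log_pos one_lt_two
  have hρ0 : 0 < ρ := by linarith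
  have h1 := Real.log_le_log (by positivity) h
  rw [Real.log_mul (by positivity) (by positivity), Real.log_pow, Real.log_pow,
    Real.log_rpow hlog] at h1
  have h2 : i + ρ / 2 * Real.log (Real.log n) ≤ omega1 n := by
    refine le_of_mul_le_mul_right ?_ hlog2
    linarith
  have h3 := mul_le_mul_of_nonneg_right h2 (Real.log_nonneg hρ)
  rw [omegaWeight, Real.rpow_neg hlog.le, ← div_eq_mul_inv, le_div_iff₀ (by positivity),
    ← Real.log_le_log_iff (by positivity) (by positivity),
    Real.log_mul (by positivity) (by positivity), Real.log_pow, Real.log_pow, Real.log_rpow hlog]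
  linarith

/-- The weighted count of sums of two squares is negligible compared with their number. -/
theorem tendsto_sum_omegaWeight_div {ρ : ℝ} (hρ : 1 < ρ) :
    Tendsto (fun y : ℕ ↦ (∑ n ∈ (sosIcc y).filter (3 ≤ ·), omegaWeight ρ n) /
      (y / √(Real.log y))) atTop (𝓝 0) := by
  have hρ0 : 0 < ρ := by linarith
  obtain ⟨C, hC, hpow⟩ := exists_pow_omega1_le hρ.le (show (0 : ℝ) < 1 / 4 by norm_num)
  obtain ⟨D, hD, hsum⟩ := exists_sum_pow_omega1_le hρ.le
  set β := ρ / 2 * Real.log ρ with hβ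
  have hβ0 : 0 ≤ β := by have := Real.log_nonneg hρ.le; positivity
  have hγ : ρ / 2 - 1 - β + 1 / 2 < 0 := by
    have h1 : Real.log ρ⁻¹ < ρ⁻¹ - 1 :=
      Real.log_lt_sub_one_of_pos (by positivity) (by rw [ne_eq, inv_eq_one]; exact hρ.ne')
    rw [Real.log_inv] at h1
    have h2 := mul_lt_mul_of_pos_left h1 hρ0
    rw [mul_sub, mul_inv_cancel₀ hρ0.ne'] at h2
    linarith
  have hlogtop : Tendsto (fun y : ℕ ↦ Real.log y) atTop atTop :=
    Real.tendsto_log_atTop.comp tendsto_natCast_atTop_atTop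
  have hlim1 : Tendsto (fun y : ℕ ↦ C * (Real.log y ^ (1 / 2 : ℝ) / (y : ℝ) ^ (3 / 8 : ℝ)))
      atTop (𝓝 0) := by
    have := ((isLittleO_log_rpow_rpow_atTop (1 / 2) (show (0 : ℝ) < 3 / 8 by norm_num)
      ).tendsto_div_nhds_zero.comp tendsto_natCast_atTop_atTop).const_mul C
    rwa [mul_zero] at this
  have hlim2 : Tendsto (fun y : ℕ ↦ 2 ^ β * D * Real.log y ^ (ρ / 2 - 1 - β + 1 / 2))
      atTop (𝓝 0) := by
    have := ((tendsto_rpow_neg_atTop (neg_pos.mpr hγ)).comp hlogtop).const_mul (2 ^ β * D)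
    simpa only [neg_neg, mul_zero, Function.comp_apply] using this
  have hlim := hlim1.add hlim2
  rw [add_zero] at hlim
  refine squeeze_zero' (Eventually.of_forall fun y ↦ div_nonneg
    (Finset.sum_nonneg fun n _ ↦ omegaWeight_nonneg hρ.le n) (by positivity)) ?_ hlim
  filter_upwards [eventually_ge_atTop 3] with y hy
  have hlog : 0 < Real.log y := zero_lt_one.trans (one_lt_log_natCast hy)
  have hy0 : (0 : ℝ) < y := by positivity
  set r := Nat.sqrt y with hr
  have hsmall : ∑ n ∈ ((sosIcc y).filter (3 ≤ ·)).filter (· ≤ r), omegaWeight ρ n ≤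
      C * (y : ℝ) ^ (5 / 8 : ℝ) := by
    have hr1 : (r : ℝ) ≤ (y : ℝ) ^ (1 / 2 : ℝ) := by
      rw [← Real.sqrt_eq_rpow]
      exact Real.nat_sqrt_le_real_sqrt
    calc _ ≤ ∑ n ∈ ((sosIcc y).filter (3 ≤ ·)).filter (· ≤ r), C * (r : ℝ) ^ (1 / 4 : ℝ) := by
          refine Finset.sum_le_sum fun n hn ↦ ?_
          simp only [Finset.mem_filter] at hn
          refine (omegaWeight_le hρ.le hn.1.2).trans ((hpow n (by omega)).trans ?_)
          have : (n : ℝ) ≤ r := by exact_mod_cast hn.2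
          gcongr
      _ ≤ r * (C * (r : ℝ) ^ (1 / 4 : ℝ)) := by
          rw [Finset.sum_const, nsmul_eq_mul]
          gcongr
          calc _ ≤ (Finset.Icc 1 r).card := Finset.card_le_card fun n hn ↦ by
                simp only [Finset.mem_filter] at hn
                exact Finset.mem_Icc.mpr ⟨by omega, hn.2⟩
            _ = r := by simp
      _ ≤ (y : ℝ) ^ (1 / 2 : ℝ) * (C * ((y : ℝ) ^ (1 / 2 : ℝ)) ^ (1 / 4 : ℝ)) := by gcongr
      _ = C * ((y : ℝ) ^ (1 / 2 : ℝ) * (y : ℝ) ^ (1 / 8 : ℝ)) := by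
          rw [← Real.rpow_mul hy0.le]; norm_num; ring
      _ = _ := by rw [← Real.rpow_add hy0]; norm_num
  have hlarge : ∑ n ∈ ((sosIcc y).filter (3 ≤ ·)).filter (¬ · ≤ r), omegaWeight ρ n ≤
      2 ^ β * D * (y * Real.log y ^ (ρ / 2 - 1 - β)) := by
    calc _ ≤ ∑ n ∈ ((sosIcc y).filter (3 ≤ ·)).filter (¬ · ≤ r),
              ρ ^ omega1 n * (Real.log y / 2) ^ (-β) := by
          refine Finset.sum_le_sum fun n hn ↦ ?_
          have hn := (Finset.mem_filter.mp hn).2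
          have h1 : y ≤ n ^ 2 := by
            calc y ≤ (r + 1) ^ 2 := (Nat.lt_succ_sqrt' y).le
              _ ≤ n ^ 2 := by gcongr; omega
          have h2 : Real.log y ≤ Real.log ((n : ℝ) ^ 2) :=
            Real.log_le_log hy0 (by exact_mod_cast h1)
          rw [Real.log_pow] at h2
          push_cast at h2
          rw [omegaWeight]
          refine mul_le_mul_of_nonneg_left ?_ (by positivity)
          exact Real.rpow_le_rpow_of_nonpos (by positivity) (by linarith) (by linarith)
      _ ≤ ∑ n ∈ sosIcc y, ρ ^ omega1 n * (Real.log y / 2) ^ (-β) :=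
          Finset.sum_le_sum_of_subset_of_nonneg
            ((Finset.filter_subset _ _).trans (Finset.filter_subset _ _))
            fun n _ _ ↦ by positivity
      _ ≤ D * y * Real.log y ^ (ρ / 2 - 1) * (Real.log y / 2) ^ (-β) := by
          rw [← Finset.sum_mul]
          gcongr
          exact hsum y hy
      _ = _ := by
          rw [Real.div_rpow hlog.le two_pos.le, Real.rpow_neg two_pos.le, div_inv_eq_mul,
            sub_eq_add_neg _ β, Real.rpow_add hlog]
          ring
  have hsplit := add_le_add hsmall hlarge
  rw [Finset.sum_filter_add_sum_filter_not] at hsplit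
  refine (div_le_div_of_nonneg_right hsplit (by positivity)).trans (le_of_eq ?_)
  rw [Real.sqrt_eq_rpow, Real.rpow_add hlog]
  have h58 : (y : ℝ) = (y : ℝ) ^ (5 / 8 : ℝ) * (y : ℝ) ^ (3 / 8 : ℝ) := by
    rw [← Real.rpow_add hy0]; norm_num
  have hlp : 0 < Real.log y ^ (1 / 2 : ℝ) := by positivity
  rw [add_div]
  congr 1
  · nth_rw 2 [h58]
    field_simp
  · field_simp

theorem fullDensityIn_of_tendsto {S : Set ℕ} (hS : S ⊆ SOS)
    (h : Tendsto (fun x : ℕ ↦ (Nat.card {m : ℕ // (m ∈ SOS ∧ m ∉ S) ∧ m ≤ x} : ℝ) /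
      (Nat.card {m : ℕ // m ∈ SOS ∧ m ≤ x} : ℝ)) atTop (𝓝 0)) : FullDensityIn S := by
  classical
  refine ⟨hS, ?_⟩
  have hcard (p : ℕ → Prop) (x : ℕ) : Nat.card {m : ℕ // p m ∧ m ≤ x} =
      ((Finset.range (x + 1)).filter p).card := by
    refine Nat.subtype_card _ fun m ↦ ?_
    rw [Finset.mem_filter, Finset.mem_range, Nat.lt_succ_iff, and_comm]
  have h' := h.const_sub 1
  rw [sub_zero] at h'
  refine h'.congr fun x ↦ ?_
  have hpos : 0 < Nat.card {m : ℕ // m ∈ SOS ∧ m ≤ x} := by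
    rw [hcard]
    refine Finset.card_pos.mpr ⟨0, Finset.mem_filter.mpr ⟨by simp, 0, 0, by simp⟩⟩
  have hsum : Nat.card {m : ℕ // m ∈ S ∧ m ≤ x} +
      Nat.card {m : ℕ // (m ∈ SOS ∧ m ∉ S) ∧ m ≤ x} = Nat.card {m : ℕ // m ∈ SOS ∧ m ≤ x} := by
    rw [hcard, hcard, hcard,
      ← Finset.card_filter_add_card_filter_not (s := Finset.filter (· ∈ SOS) _) (· ∈ S),
      Finset.filter_filter, Finset.filter_filter]
    congr 2 <;> ext m <;> simp only [Finset.mem_filter]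
    exact ⟨fun h ↦ ⟨h.1, hS h.2, h.2⟩, fun h ↦ ⟨h.1, h.2.2⟩⟩
  have hsum' : (Nat.card {m : ℕ // m ∈ S ∧ m ≤ x} : ℝ) +
      Nat.card {m : ℕ // (m ∈ SOS ∧ m ∉ S) ∧ m ≤ x} = Nat.card {m : ℕ // m ∈ SOS ∧ m ≤ x} := by
    exact_mod_cast hsum
  have hpos' : (0 : ℝ) < Nat.card {m : ℕ // m ∈ SOS ∧ m ≤ x} := by exact_mod_cast hpos
  rw [eq_div_iff hpos'.ne', sub_mul, div_mul_cancel₀ _ hpos'.ne']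
  linarith

/-- The sums of two squares that are separated from every `n` of weight at least `1` by at least
that weight. -/
def wellSeparated (ρ : ℝ) : Set ℕ :=
  {m | m ∈ SOS ∧ ∀ n ∈ SOS, 3 ≤ n → 1 ≤ omegaWeight ρ n → omegaWeight ρ n ≤ betweenCount m n}

theorem eventually_card_not_wellSeparated_le {ρ : ℝ} (hρ : 1 ≤ ρ) :
    ∀ᶠ x : ℕ in atTop, (Nat.card {m : ℕ // (m ∈ SOS ∧ m ∉ wellSeparated ρ) ∧ m ≤ x} : ℝ) ≤
      5 * ∑ n ∈ (sosIcc (4 * x)).filter (3 ≤ ·), omegaWeight ρ n := by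
  classical
  obtain ⟨C, hC, hpow⟩ := exists_pow_omega1_le hρ (show (0 : ℝ) < 1 / 4 by norm_num)
  filter_upwards [((tendsto_rpow_atTop (show (0 : ℝ) < 1 / 4 by norm_num)).comp
    tendsto_natCast_atTop_atTop).eventually_ge_atTop (2 * C + 2)] with x hx
  simp only [Function.comp_apply] at hx
  set T : ℕ → Finset ℕ := fun n ↦ (Finset.range (x + 1)).filter fun m ↦
    1 ≤ omegaWeight ρ n ∧ m ∈ SOS ∧ (betweenCount m n : ℝ) < omegaWeight ρ n with hTdef
  have hT (n : ℕ) : ((T n).card : ℝ) ≤ 5 * omegaWeight ρ n := by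
    by_cases h1 : 1 ≤ omegaWeight ρ n
    · have := card_le_of_betweenCount_lt (omegaWeight_nonneg hρ n) (T n) fun m hm ↦
        (Finset.mem_filter.mp hm).2.2
      linarith
    · have : T n = ∅ := Finset.filter_false_of_mem fun m _ h ↦ h1 h.1
      rw [this]
      simpa using omegaWeight_nonneg hρ n
  have hcover : Nat.card {m : ℕ // (m ∈ SOS ∧ m ∉ wellSeparated ρ) ∧ m ≤ x} ≤
      (((sosIcc (4 * x)).filter (3 ≤ ·)).biUnion T).card := by
    rw [Nat.subtype_card ((Finset.range (x + 1)).filter fun m ↦ m ∈ SOS ∧ m ∉ wellSeparated ρ)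
      fun m ↦ by rw [Finset.mem_filter, Finset.mem_range, Nat.lt_succ_iff, and_comm]]
    refine Finset.card_le_card fun m hm ↦ ?_
    obtain ⟨hmx, hmS, hm⟩ := Finset.mem_filter.mp hm
    obtain ⟨n, hnS, hn3, hn1, hlt⟩ : ∃ n ∈ SOS, 3 ≤ n ∧ 1 ≤ omegaWeight ρ n ∧
        (betweenCount m n : ℝ) < omegaWeight ρ n := by
      by_contra! h
      exact hm ⟨hmS, h⟩
    refine Finset.mem_biUnion.mpr ⟨n, Finset.mem_filter.mpr ⟨mem_sosIcc.mpr
      ⟨by omega, ?_, hnS⟩, hn3⟩, Finset.mem_filter.mpr ⟨hmx, hn1, hmS, hlt⟩⟩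
    by_contra! hnx
    have h1 := sqrt_le_betweenCount (Nat.lt_succ_iff.mp (Finset.mem_range.mp hmx)) hnx
    have h2 := (omegaWeight_le hρ hn3).trans (hpow n (by omega))
    have h3 : 2 * C + 2 ≤ (n : ℝ) ^ (1 / 4 : ℝ) := by
      refine hx.trans ?_
      have : (x : ℝ) ≤ n := by exact_mod_cast (by omega)
      gcongr
    have h4 : √(n : ℝ) = (n : ℝ) ^ (1 / 4 : ℝ) * (n : ℝ) ^ (1 / 4 : ℝ) := by
      rw [Real.sqrt_eq_rpow, ← Real.rpow_add (by positivity)]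
      norm_num
    nlinarith
  calc (Nat.card {m : ℕ // (m ∈ SOS ∧ m ∉ wellSeparated ρ) ∧ m ≤ x} : ℝ)
      ≤ ∑ n ∈ (sosIcc (4 * x)).filter (3 ≤ ·), ((T n).card : ℝ) := by
        exact_mod_cast hcover.trans Finset.card_biUnion_le
    _ ≤ _ := by
        rw [Finset.mul_sum]
        exact Finset.sum_le_sum fun n _ ↦ hT n

theorem SatheSelberg.fullDensityIn_wellSeparated (h : SatheSelberg) {ρ : ℝ} (hρ : 1 < ρ) :
    FullDensityIn (wellSeparated ρ) := by
  obtain ⟨c, hc, hlow⟩ := h.exists_le_card_sosIcc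
  refine fullDensityIn_of_tendsto (fun m hm ↦ hm.1) ?_
  have hlim := ((tendsto_sum_omegaWeight_div hρ).comp
    (tendsto_id.const_mul_atTop' (show 0 < 4 by norm_num))).const_mul (20 / c)
  rw [mul_zero] at hlim
  refine squeeze_zero' (Eventually.of_forall fun x ↦ by positivity) ?_ hlim
  filter_upwards [hlow, eventually_card_not_wellSeparated_le hρ.le, eventually_ge_atTop 3]
    with x hx hbad hx3
  simp only [Function.comp_apply, id_eq]
  set W := ∑ n ∈ (sosIcc (4 * x)).filter (3 ≤ ·), omegaWeight ρ n
  have hW : 0 ≤ W := Finset.sum_nonneg fun n _ ↦ omegaWeight_nonneg hρ.le n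
  have hlog : 0 < Real.log x := zero_lt_one.trans (one_lt_log_natCast hx3)
  have hx0 : (0 : ℝ) < x := by positivity
  have hlog4 : Real.log x ≤ Real.log (4 * x : ℕ) :=
    Real.log_le_log hx0 (by exact_mod_cast (by omega))
  have hcard : ((sosIcc x).card : ℝ) ≤ Nat.card {m : ℕ // m ∈ SOS ∧ m ≤ x} := by
    classical
    rw [Nat.subtype_card ((Finset.range (x + 1)).filter (· ∈ SOS))
      fun m ↦ by rw [Finset.mem_filter, Finset.mem_range, Nat.lt_succ_iff, and_comm]]
    exact_mod_cast Finset.card_le_card fun m hm ↦ by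
      obtain ⟨-, h1, h2⟩ := mem_sosIcc.mp hm
      exact Finset.mem_filter.mpr ⟨Finset.mem_range.mpr (by omega), h2⟩
  have hcount : c / 4 * ((4 * x : ℕ) / √(Real.log (4 * x : ℕ))) ≤
      (Nat.card {m : ℕ // m ∈ SOS ∧ m ≤ x} : ℝ) := by
    refine le_trans ?_ (hx.trans hcard)
    calc c / 4 * (((4 * x : ℕ) : ℝ) / √(Real.log (4 * x : ℕ)))
        = c * (x / √(Real.log (4 * x : ℕ))) := by push_cast; ring
      _ ≤ _ := by
        have : 0 < √(Real.log x) := Real.sqrt_pos.mpr hlog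
        gcongr
  have hpos : 0 < ((4 * x : ℕ) : ℝ) / √(Real.log (4 * x : ℕ)) :=
    div_pos (by positivity) (Real.sqrt_pos.mpr (hlog.trans_le hlog4))
  calc _ ≤ 5 * W / (c / 4 * ((4 * x : ℕ) / √(Real.log (4 * x : ℕ)))) :=
        div_le_div₀ (by positivity) hbad (by positivity) hcount
    _ = _ := by field_simp; ring

/-- Separation of elements of `𝒩` with large `2^{ω₁(n)}`, under the Sathe–Selberg analogue. -/
theorem medium_omega1_separation (hSS : SatheSelberg) (η : ℝ) (hη : 0 < η) :
    ∃ (c : ℝ) (S : Set ℕ), 0 < c ∧ FullDensityIn S ∧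
      ∀ m ∈ S, ∀ i : ℕ, ∀ n ∈ SOS,
        (2 : ℝ) ^ i * Real.log n ^ (1 / 2 * Real.log 2 + η) ≤ (2 : ℝ) ^ omega1 n →
        (2 : ℝ) ^ omega1 n ≤ Real.log n ^ 2 →
        c * (1 + 2 * η / Real.log 2) ^ i /
            (Real.log ((2 : ℝ) ^ omega1 n) ^ 2 * Real.log (Real.log n))
          ≤ (betweenCount m n : ℝ) := by
  have hlog2 : 0 < Real.log 2 := Real.log_pos one_lt_two
  set ρ := 1 + 2 * η / Real.log 2 with hρdef
  have hρ : 1 < ρ := lt_add_of_pos_right 1 (by positivity)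
  have hexp : 1 / 2 * Real.log 2 + η = ρ / 2 * Real.log 2 := by
    rw [hρdef]
    field_simp
  have hll3 : 0 < Real.log (Real.log (3 : ℕ)) := Real.log_pos (one_lt_log_natCast le_rfl)
  refine ⟨Real.log 2 ^ 2 * Real.log (Real.log (3 : ℕ)), wellSeparated ρ, by positivity,
    hSS.fullDensityIn_wellSeparated hρ, fun m hm i n hn h1 _ ↦ ?_⟩
  rw [Real.log_pow]
  have hnum : 0 ≤ Real.log 2 ^ 2 * Real.log (Real.log (3 : ℕ)) * ρ ^ i := by positivity
  rcases (omega1 n).eq_zero_or_pos with hω | hω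
  · rw [hω]
    simp
  rcases le_or_gt (Real.log (Real.log n)) 0 with hll | hll
  · exact (div_nonpos_of_nonneg_of_nonpos hnum
      (mul_nonpos_of_nonneg_of_nonpos (sq_nonneg _) hll)).trans (Nat.cast_nonneg _)
  have hn3 : 3 ≤ n := by
    by_contra! h
    refine hll.not_ge (Real.log_nonpos (Real.log_natCast_nonneg n) ?_)
    interval_cases n
    · simp
    · simp
    · exact (Real.log_two_lt_d9.trans (by norm_num)).le
  have hweight : ρ ^ i ≤ omegaWeight ρ n := pow_le_omegaWeight hρ.le hn3 (hexp ▸ h1)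
  refine le_trans ?_ (hweight.trans (hm.2 n hn hn3 ((one_le_pow₀ hρ.le).trans hweight)))
  have hω1 : (1 : ℝ) ≤ omega1 n := by exact_mod_cast hω
  rw [div_le_iff₀ (by positivity), mul_comm]
  refine mul_le_mul_of_nonneg_left ?_ (by positivity)
  have hn3' : ((3 : ℕ) : ℝ) ≤ n := by exact_mod_cast hn3
  have hlog3 := one_lt_log_natCast (le_refl 3)
  gcongr
  exact le_mul_of_one_le_left hlog2.le hω1
end
end

section
/- For every complex s with Re s > 1, Σ_{n=1}^{∞} r₂(n)·n^{−s} = Σ_{(m,n)∈ℤ²∖{(0,0)}} (m² + n²)^{−s} = 4·ζ(s)·L(s, χ₄), where ζ is the Riemann zeta function and L(·, χ₄) is the Dirichlet L-function of the nontrivial Dirichlet character χ₄ modulo 4. That is, the Epstein zeta function of the square lattice factorizes as 4·ζ(s)·L(s, χ₄). -/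
open Filter Topology

noncomputable section

/-- The unique nontrivial Dirichlet character mod 4, as an arithmetic function:
`χ₄(n) = 1` if `n ≡ 1 [MOD 4]`, `χ₄(n) = −1` if `n ≡ 3 [MOD 4]`, and `χ₄(n) = 0`
if `n` is even. -/
def chi4 (n : ℕ) : ℂ := if n % 4 = 1 then 1 else if n % 4 = 3 then -1 else 0

open Finset

/-- The integer points on the circle `x² + y² = n`. -/
def circlePoints (n : ℕ) : Finset (ℤ × ℤ) :=
  (Icc (-(n : ℤ)) n ×ˢ Icc (-(n : ℤ)) n).filter fun z ↦ z.1 ^ 2 + z.2 ^ 2 = n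

lemma mem_circlePoints {n : ℕ} {z : ℤ × ℤ} :
    z ∈ circlePoints n ↔ z.1 ^ 2 + z.2 ^ 2 = n := by
  simp only [circlePoints, mem_filter, mem_product, mem_Icc, and_iff_right_iff_imp]
  intro h
  have abs_le_sq (x : ℤ) : |x| ≤ x ^ 2 := by
    rw [← Int.natCast_natAbs, ← Int.natAbs_sq]
    exact_mod_cast Nat.le_self_pow two_ne_zero _
  exact ⟨abs_le.1 ((abs_le_sq z.1).trans (by linarith [sq_nonneg z.2])),
    abs_le.1 ((abs_le_sq z.2).trans (by linarith [sq_nonneg z.1]))⟩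

lemma r2_eq_card_circlePoints (n : ℕ) : r2 n = #(circlePoints n) := by
  rw [r2, Nat.subtype_card]
  exact fun _ ↦ mem_circlePoints

lemma card_circlePoints_two_mul (n : ℕ) : #(circlePoints (2 * n)) = #(circlePoints n) := by
  symm
  refine card_nbij' (fun z ↦ (z.1 + z.2, z.1 - z.2))
    (fun z ↦ ((z.1 + z.2) / 2, (z.1 - z.2) / 2)) ?_ ?_ ?_ ?_
  · rintro ⟨x, y⟩ h
    simp only [mem_coe, mem_circlePoints] at h ⊢
    push_cast
    linear_combination 2 * h
  · rintro ⟨x, y⟩ h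
    simp only [mem_coe, mem_circlePoints] at h ⊢
    push_cast at h
    have hxy : Even (x + y) := by
      have : Even (x ^ 2 + y ^ 2) := ⟨n, by linear_combination h⟩
      simpa [Int.even_add, Int.even_pow] using this
    obtain ⟨u, hu⟩ := hxy
    rw [show (x + y) / 2 = u by omega, show (x - y) / 2 = u - y by omega]
    obtain rfl : x = 2 * u - y := by omega
    linarith
  · rintro ⟨x, y⟩ -
    ext <;> dsimp only <;> omega
  · rintro ⟨x, y⟩ h
    simp only [mem_coe, mem_circlePoints] at h
    push_cast at h
    have hxy : Even (x + y) := by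
      have : Even (x ^ 2 + y ^ 2) := ⟨n, by linear_combination h⟩
      simpa [Int.even_add, Int.even_pow] using this
    obtain ⟨u, hu⟩ := hxy
    ext <;> dsimp only <;> omega

lemma card_circlePoints_filter_dvd {p : ℕ} (hp : 0 < p) (n : ℕ) :
    #{z ∈ circlePoints (p * n) | (p : ℤ) ∣ z.1 ∧ (p : ℤ) ∣ z.2} =
      if p ∣ n then #(circlePoints (n / p)) else 0 := by
  have hp' : (p : ℤ) ≠ 0 := by positivity
  split_ifs with h
  · obtain ⟨m, rfl⟩ := h
    rw [Nat.mul_div_cancel_left m hp]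
    symm
    refine card_nbij (fun z ↦ (p * z.1, p * z.2)) ?_ ?_ ?_
    · rintro ⟨x, y⟩ h
      simp only [mem_coe, mem_filter, mem_circlePoints] at h ⊢
      refine ⟨?_, Dvd.intro _ rfl, Dvd.intro _ rfl⟩
      push_cast
      linear_combination (p : ℤ) ^ 2 * h
    · rintro ⟨x, y⟩ - ⟨u, v⟩ - h
      simpa [hp.ne'] using h
    · rintro ⟨x, y⟩ h
      simp only [mem_coe, mem_filter, mem_circlePoints] at h
      obtain ⟨h, ⟨u, rfl⟩, ⟨v, rfl⟩⟩ := h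
      refine ⟨(u, v), ?_, rfl⟩
      simp only [mem_coe, mem_circlePoints]
      push_cast at h
      exact mul_left_cancel₀ (pow_ne_zero 2 hp') (by linear_combination h)
  · rw [card_eq_zero, filter_eq_empty_iff]
    rintro ⟨x, y⟩ hz ⟨⟨u, rfl⟩, ⟨v, rfl⟩⟩
    simp only [mem_circlePoints] at hz
    push_cast at hz
    refine h (Int.natCast_dvd_natCast.1 ⟨u ^ 2 + v ^ 2, ?_⟩)
    exact mul_left_cancel₀ hp' (by linear_combination -hz)

lemma dvd_and_dvd_of_dvd_sq_add_sq {p : ℕ} (hp : p.Prime) (h3 : p % 4 = 3) {x y : ℤ}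
    (h : (p : ℤ) ∣ x ^ 2 + y ^ 2) : (p : ℤ) ∣ x ∧ (p : ℤ) ∣ y := by
  have := Fact.mk hp
  have key : ∀ {x y : ℤ}, (p : ℤ) ∣ x ^ 2 + y ^ 2 → (p : ℤ) ∣ x := by
    intro x y h
    by_contra hx
    refine ZMod.mod_four_ne_three_of_sq_eq_neg_sq' (p := p) (x := (y : ZMod p))
      (y := (x : ZMod p)) (by rwa [Ne, ZMod.intCast_zmod_eq_zero_iff_dvd]) ?_ h3
    have := (ZMod.intCast_zmod_eq_zero_iff_dvd _ p).2 h
    push_cast at this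
    linear_combination this
  exact ⟨key h, key (by rwa [add_comm])⟩

lemma card_circlePoints_prime_mul_of_mod_four_eq_three {p : ℕ} (hp : p.Prime) (h3 : p % 4 = 3)
    (n : ℕ) :
    #(circlePoints (p * n)) = if p ∣ n then #(circlePoints (n / p)) else 0 := by
  rw [← card_circlePoints_filter_dvd hp.pos, filter_true_of_mem]
  intro z hz
  apply dvd_and_dvd_of_dvd_sq_add_sq hp h3
  rw [mem_circlePoints.1 hz]
  exact ⟨n, by push_cast; rfl⟩

/-- Multiplication by `a + bi`, in coordinates, maps the circle of square radius `n` bijectively to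
the points of the circle of square radius `(a² + b²) n` that are divisible by `a + bi`. -/
lemma card_circlePoints_filter_dvd_mul {a b : ℤ} {p : ℕ} (hp : p.Prime) (hab : a ^ 2 + b ^ 2 = p)
    (n : ℕ) :
    #{z ∈ circlePoints (p * n) | (p : ℤ) ∣ a * z.1 + b * z.2} = #(circlePoints n) := by
  have hp' : (p : ℤ) ≠ 0 := mod_cast hp.ne_zero
  symm
  refine card_nbij (fun z ↦ (a * z.1 - b * z.2, b * z.1 + a * z.2)) ?_ ?_ ?_
  · rintro ⟨x, y⟩ h
    simp only [mem_coe, mem_filter, mem_circlePoints] at h ⊢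
    refine ⟨?_, x, ?_⟩
    · push_cast
      rw [← h, ← hab]
      ring
    · rw [← hab]
      ring
  · rintro ⟨x, y⟩ - ⟨u, v⟩ - h
    simp only [Prod.mk.injEq] at h
    obtain ⟨h1, h2⟩ := h
    ext <;> dsimp only <;> apply mul_left_cancel₀ hp' <;> rw [← hab]
    · linear_combination a * h1 + b * h2
    · linear_combination a * h2 - b * h1
  · rintro ⟨x, y⟩ h
    simp only [mem_coe, mem_filter, mem_circlePoints] at h
    obtain ⟨h, u, hu⟩ := h
    push_cast at h
    have hv : (p : ℤ) ∣ a * y - b * x := by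
      apply (Nat.prime_iff_prime_int.1 hp).dvd_of_dvd_pow (n := 2)
      refine ⟨p * n - p * u ^ 2, ?_⟩
      linear_combination (-(a * x + b * y) - p * u) * hu + (a ^ 2 + b ^ 2) * h + (p * n) * hab
    obtain ⟨v, hv⟩ := hv
    refine ⟨(u, v), ?_, ?_⟩
    · simp only [mem_coe, mem_circlePoints]
      apply mul_left_cancel₀ (pow_ne_zero 2 hp')
      linear_combination -(a * x + b * y + p * u) * hu - (a * y - b * x + p * v) * hv +
        (a ^ 2 + b ^ 2) * h + (p * n) * hab
    · ext <;> dsimp only <;> apply mul_left_cancel₀ hp'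
      · linear_combination -a * hu + b * hv + x * hab
      · linear_combination -b * hu - a * hv + y * hab

lemma card_circlePoints_prime_mul_of_mod_four_eq_one {p : ℕ} (hp : p.Prime) (h1 : p % 4 = 1)
    (n : ℕ) :
    #(circlePoints (p * n)) + (if p ∣ n then #(circlePoints (n / p)) else 0) =
      2 * #(circlePoints n) := by
  have := Fact.mk hp
  have hpi := Nat.prime_iff_prime_int.1 hp
  obtain ⟨a, b, hab⟩ := Nat.Prime.sq_add_sq (p := p) (by omega)
  zify at hab
  have hab' : (a : ℤ) ^ 2 + (-b : ℤ) ^ 2 = p := by rw [← hab]; ring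
  have h2 : ¬ (p : ℤ) ∣ 2 := by
    intro h
    have := Nat.le_of_dvd two_pos (Int.natCast_dvd_natCast.1 h)
    have := hp.two_le
    omega
  have not_dvd : ∀ {a b : ℤ}, a ^ 2 + b ^ 2 = p → ¬ (p : ℤ) ∣ a := by
    rintro a b hab ⟨u, rfl⟩
    have hb : (p : ℤ) ∣ b := hpi.dvd_of_dvd_pow (n := 2)
      ⟨1 - p * u ^ 2, by linear_combination hab⟩
    obtain ⟨v, rfl⟩ := hb
    refine hpi.not_isUnit (IsUnit.of_mul_eq_one (u ^ 2 + v ^ 2) ?_)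
    exact mul_left_cancel₀ hpi.ne_zero (by linear_combination hab)
  have ha := not_dvd hab
  have hb := not_dvd (a := b) (b := a) (by rw [← hab]; ring)
  rw [← card_circlePoints_filter_dvd hp.pos, two_mul]
  nth_rw 2 [← card_circlePoints_filter_dvd_mul hp hab' n]
  rw [← card_circlePoints_filter_dvd_mul hp hab n,
    ← card_union_add_card_inter (filter _ _) (filter _ _), ← filter_or, ← filter_and]
  congr 2
  · symm
    rw [filter_true_of_mem]
    rintro ⟨x, y⟩ hz
    rw [mem_circlePoints] at hz
    push_cast at hz
    apply hpi.dvd_or_dvd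
    refine ⟨a ^ 2 * n - y ^ 2, ?_⟩
    linear_combination (a : ℤ) ^ 2 * hz - y ^ 2 * hab
  · refine filter_congr fun z _ ↦ ⟨fun ⟨hx, hy⟩ ↦
      ⟨dvd_add (hx.mul_left _) (hy.mul_left _), dvd_add (hx.mul_left _) (hy.mul_left _)⟩, ?_⟩
    rintro ⟨h, h'⟩
    have hx : (p : ℤ) ∣ 2 * (a * z.1) := by
      rw [show 2 * (a * z.1) = a * z.1 + b * z.2 + (a * z.1 + -b * z.2) by ring]
      exact dvd_add h h'
    have hy : (p : ℤ) ∣ 2 * (b * z.2) := by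
      rw [show 2 * (b * z.2) = a * z.1 + b * z.2 - (a * z.1 + -b * z.2) by ring]
      exact dvd_sub h h'
    exact ⟨((hpi.dvd_or_dvd ((hpi.dvd_or_dvd hx).resolve_left h2)).resolve_left ha),
      ((hpi.dvd_or_dvd ((hpi.dvd_or_dvd hy).resolve_left h2)).resolve_left hb)⟩

/-- The Hecke relation at `p` for the number of representations as a sum of two squares. -/
lemma card_circlePoints_prime_mul {p : ℕ} (hp : p.Prime) (n : ℕ) :
    (#(circlePoints (p * n)) : ℤ) = (1 + ZMod.χ₄ p) * #(circlePoints n) -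
      ZMod.χ₄ p * if p ∣ n then (#(circlePoints (n / p)) : ℤ) else 0 := by
  rcases hp.eq_two_or_odd with rfl | hodd
  · rw [card_circlePoints_two_mul, show ZMod.χ₄ ((2 : ℕ) : ZMod 4) = 0 by decide]
    ring
  obtain h1 | h3 : p % 4 = 1 ∨ p % 4 = 3 := by omega
  · rw [ZMod.χ₄_nat_one_mod_four h1]
    have := card_circlePoints_prime_mul_of_mod_four_eq_one hp h1 n
    have := congrArg (Nat.cast : ℕ → ℤ) this
    push_cast at this
    linear_combination this
  · rw [ZMod.χ₄_nat_three_mod_four h3, card_circlePoints_prime_mul_of_mod_four_eq_three hp h3]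
    push_cast
    ring

/-- The Hecke relation at `p` for the divisor sums of a completely multiplicative function. -/
lemma sum_divisors_prime_mul {R : Type*} [CommRing R] (f : ℕ →* R) {p n : ℕ} (hp : p.Prime)
    (hn : n ≠ 0) :
    ∑ d ∈ (p * n).divisors, f d = (1 + f p) * ∑ d ∈ n.divisors, f d -
      f p * if p ∣ n then ∑ d ∈ (n / p).divisors, f d else 0 := by
  have hinj : Function.Injective (p * ·) := mul_right_injective₀ hp.ne_zero
  have hunion : (p * n).divisors = n.divisors ∪ n.divisors.image (p * ·) := by
    ext d
    simp only [Nat.mem_divisors, mem_union, mem_image, ne_eq, mul_eq_zero, hp.ne_zero, hn,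
      not_false_eq_true, and_true, or_self]
    constructor
    · intro h
      by_cases hd : p ∣ d
      · obtain ⟨e, rfl⟩ := hd
        exact .inr ⟨e, Nat.dvd_of_mul_dvd_mul_left hp.pos h, rfl⟩
      · exact .inl (((hp.coprime_iff_not_dvd.2 hd).symm).dvd_of_dvd_mul_left h)
    · rintro (h | ⟨e, h, rfl⟩)
      · exact h.mul_left p
      · exact mul_dvd_mul_left p h
  have hinter : ∑ d ∈ n.divisors ∩ n.divisors.image (p * ·), f d =
      f p * if p ∣ n then ∑ d ∈ (n / p).divisors, f d else 0 := by
    split_ifs with h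
    · obtain ⟨m, rfl⟩ := h
      have hm : m ≠ 0 := right_ne_zero_of_mul hn
      rw [Nat.mul_div_cancel_left m hp.pos, mul_sum]
      simp_rw [← map_mul]
      rw [← sum_image (g := (p * ·)) (f := fun d ↦ f d) hinj.injOn]
      congr 1
      ext d
      simp only [mem_inter, mem_image, Nat.mem_divisors]
      constructor
      · rintro ⟨⟨h, -⟩, e, -, rfl⟩
        exact ⟨e, ⟨Nat.dvd_of_mul_dvd_mul_left hp.pos h, hm⟩, rfl⟩
      · rintro ⟨e, ⟨h, -⟩, rfl⟩
        exact ⟨⟨mul_dvd_mul_left p h, hn⟩, e, ⟨h.mul_left p, hn⟩, rfl⟩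
    · rw [mul_zero]
      refine sum_eq_zero fun d hd ↦ absurd ?_ h
      simp only [mem_inter, mem_image, Nat.mem_divisors] at hd
      obtain ⟨⟨hd, -⟩, e, -, rfl⟩ := hd
      exact (Dvd.intro e rfl).trans hd
  have himage : ∑ d ∈ n.divisors.image (p * ·), f d = f p * ∑ d ∈ n.divisors, f d := by
    rw [sum_image hinj.injOn, mul_sum]
    simp
  have := sum_union_inter (s₁ := n.divisors) (s₂ := n.divisors.image (p * ·)) (f := fun d ↦ f d)
  rw [hunion]
  linear_combination this - hinter + himage

/-- Jacobi's two-square theorem. -/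
theorem card_circlePoints_eq_four_mul_sum {n : ℕ} (hn : n ≠ 0) :
    (#(circlePoints n) : ℤ) = 4 * ∑ d ∈ n.divisors, ZMod.χ₄ d := by
  induction n using Nat.strong_induction_on with
  | _ n ih =>
    rcases eq_or_ne n 1 with rfl | h1
    · decide
    obtain ⟨p, hp, m, rfl⟩ := Nat.exists_prime_and_dvd h1
    have hm : m ≠ 0 := right_ne_zero_of_mul hn
    have hlt : m < p * m := lt_mul_of_one_lt_left (Nat.pos_of_ne_zero hm) hp.one_lt
    have hecke := sum_divisors_prime_mul
      ((ZMod.χ₄ : ZMod 4 →* ℤ).comp (Nat.castRingHom (ZMod 4) : ℕ →* ZMod 4)) hp hm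
    simp only [MonoidHom.comp_apply, MonoidHom.coe_coe, Nat.coe_castRingHom] at hecke
    rw [card_circlePoints_prime_mul hp, ih m hlt hm, hecke]
    split_ifs with h
    · have hdiv : m / p ≠ 0 := (Nat.div_pos (Nat.le_of_dvd (Nat.pos_of_ne_zero hm) h) hp.pos).ne'
      rw [ih (m / p) ((Nat.div_le_self m p).trans_lt hlt) hdiv]
      ring
    · ring

lemma chi4_eq_χ₄ (n : ℕ) : chi4 n = (ZMod.χ₄ n : ℂ) := by
  rw [chi4, ZMod.χ₄_nat_eq_if_mod_four]
  split_ifs <;> first | omega | simp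

open scoped LSeries.notation in
lemma r2_eq_four_mul_convolution {n : ℕ} (hn : n ≠ 0) :
    (r2 n : ℂ) = ((4 : ℂ) • (1 ⍟ chi4)) n := by
  have h : (r2 n : ℂ) = 4 * ∑ d ∈ n.divisors, chi4 d := by
    simp_rw [r2_eq_card_circlePoints, chi4_eq_χ₄]
    exact_mod_cast congrArg (Int.cast : ℤ → ℂ) (card_circlePoints_eq_four_mul_sum hn)
  rw [h, Pi.smul_apply, LSeries.convolution_def, smul_eq_mul]
  simp only [Pi.one_apply, one_mul]
  rw [Nat.sum_divisorsAntidiagonal' (f := fun _ d ↦ chi4 d)]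

lemma LSeriesHasSum_r2 {s : ℂ} (hs : 1 < s.re) :
    LSeriesHasSum (fun n ↦ (r2 n : ℂ)) s (4 * riemannZeta s * LSeries chi4 s) := by
  have hχ : LSeriesSummable chi4 s := by
    refine LSeriesSummable_of_bounded_of_one_lt_re (m := 1) (fun n _ ↦ ?_) hs
    rw [chi4]
    split_ifs <;> simp
  have h := ((LSeriesHasSum_one hs).convolution hχ.LSeriesHasSum).smul 4
  rw [mul_assoc]
  exact (LSeriesHasSum_congr s _ r2_eq_four_mul_convolution).2 h

lemma hasSum_r2_succ {s : ℂ} (hs : 1 < s.re) :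
    HasSum (fun n : ℕ ↦ (r2 (n + 1) : ℂ) * ((n + 1 : ℕ) : ℂ) ^ (-s))
      (4 * riemannZeta s * LSeries chi4 s) := by
  have h := (hasSum_nat_add_iff' 1).2 (LSeriesHasSum_r2 hs)
  simp only [range_one, sum_singleton, LSeries.term_zero, sub_zero] at h
  simpa only [LSeries.term_of_ne_zero (Nat.succ_ne_zero _), Complex.cpow_neg, div_eq_mul_inv] using h

/-- Sorting the nonzero lattice points by their square norm. -/
def sigmaCircleEquiv :
    (Σ n : ℕ, {z : ℤ × ℤ // z.1 ^ 2 + z.2 ^ 2 = ((n + 1 : ℕ) : ℤ)}) ≃ {z : ℤ × ℤ // z ≠ 0} where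
  toFun x := ⟨x.2.1, by
    obtain ⟨n, z, hz⟩ := x
    rintro rfl
    simp only [Prod.fst_zero, Prod.snd_zero] at hz
    omega⟩
  invFun z := ⟨(z.1.1 ^ 2 + z.1.2 ^ 2).toNat - 1, z.1, by
    obtain ⟨⟨x, y⟩, hz⟩ := z
    have : 0 < x ^ 2 + y ^ 2 := by
      by_contra! h
      exact hz (Prod.ext (show x = 0 by nlinarith) (show y = 0 by nlinarith))
    dsimp only
    omega⟩
  left_inv := by
    rintro ⟨n, z, hz⟩
    have : (z.1 ^ 2 + z.2 ^ 2).toNat - 1 = n := by omega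
    subst this
    rfl
  right_inv _ := rfl

lemma tsum_r2_succ_eq_tsum_lattice {s : ℂ} (hs : 1 < s.re) :
    ∑' n : ℕ, (r2 (n + 1) : ℂ) * ((n + 1 : ℕ) : ℂ) ^ (-s) =
      ∑' z : {z : ℤ × ℤ // z ≠ 0}, ((z.1.1 ^ 2 + z.1.2 ^ 2 : ℤ) : ℂ) ^ (-s) := by
  have hfin (n : ℕ) : Finite {z : ℤ × ℤ // z.1 ^ 2 + z.2 ^ 2 = (n : ℤ)} :=
    (circlePoints n).finite_toSet.subset fun _ h ↦ mem_coe.2 (mem_circlePoints.2 h)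
  have hterm (x : Σ n : ℕ, {z : ℤ × ℤ // z.1 ^ 2 + z.2 ^ 2 = ((n + 1 : ℕ) : ℤ)}) :
      (((sigmaCircleEquiv x).1.1 ^ 2 + (sigmaCircleEquiv x).1.2 ^ 2 : ℤ) : ℂ) ^ (-s) =
        ((x.1 + 1 : ℕ) : ℂ) ^ (-s) := by
    change ((x.2.1.1 ^ 2 + x.2.1.2 ^ 2 : ℤ) : ℂ) ^ (-s) = _
    rw [x.2.2, Int.cast_natCast]
  rw [← sigmaCircleEquiv.tsum_eq]
  simp_rw [hterm]
  have hsummable : Summable fun x : Σ n : ℕ,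
      {z : ℤ × ℤ // z.1 ^ 2 + z.2 ^ 2 = ((n + 1 : ℕ) : ℤ)} ↦ ((x.1 + 1 : ℕ) : ℂ) ^ (-s) := by
    rw [← summable_norm_iff, summable_sigma_of_nonneg fun _ ↦ norm_nonneg _]
    refine ⟨fun n ↦ ?_, ?_⟩
    · have := hfin (n + 1)
      exact Summable.of_finite
    · convert (hasSum_r2_succ hs).summable.norm using 2 with n
      dsimp only
      rw [tsum_const, norm_mul, nsmul_eq_mul, Complex.norm_natCast, r2]
  rw [hsummable.tsum_sigma]
  refine tsum_congr fun n ↦ ?_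
  dsimp only
  rw [tsum_const, nsmul_eq_mul, r2]

/-- Factorization of the Epstein zeta function of the square lattice:
`∑_{n≥1} r₂(n) n^{−s} = ∑_{ξ ∈ ℤ²∖{0}} |ξ|^{−2s} = 4 ζ(s) L(s, χ₄)` for `Re s > 1`. -/
theorem epstein_factorization (s : ℂ) (hs : 1 < s.re) :
    (∑' n : ℕ, (r2 (n + 1) : ℂ) * (((n + 1 : ℕ) : ℂ)) ^ (-s)
        = ∑' p : {p : ℤ × ℤ // p ≠ 0},
            (((p : ℤ × ℤ).1 ^ 2 + (p : ℤ × ℤ).2 ^ 2 : ℤ) : ℂ) ^ (-s)) ∧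
    (∑' n : ℕ, (r2 (n + 1) : ℂ) * (((n + 1 : ℕ) : ℂ)) ^ (-s)
        = 4 * riemannZeta s * LSeries chi4 s) := by
  exact ⟨tsum_r2_succ_eq_tsum_lattice hs, (hasSum_r2_succ hs).tsum_eq⟩
end
end
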